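/- arXiv:2206.04172 — 3 statements merged into one kernel-verified Lean document; each statement's English description precedes it below -/
import Mathlib

section
/- Consider the sequence (v_t, w_{x,t}, w_{y,t}) in ℝ³ evolving by: v_{t+1} = v_t + K·w_{x,t}·(1 − v_t·w_{x,t} − γ_t) + K·(w_{y,t}²/v_t)·(−v_t² + v_t·w_{y,t}/(π·‖w_t‖²)); w_{x,t+1} = w_{x,t} + K·v_t·(1 − v_t·w_{x,t} − γ_t); w_{y,t+1} = | w_{y,t} + K·w_{y,t}·(−v_t² + v_t·w_{y,t}/(π·‖w_t‖²)) |; where ‖w_t‖² = w_{x,t}² + w_{y,t}² and γ_t = (1/π)·(α_t − w_{x,t}·w_{y,t}/‖w_t‖²) with α_t = arctan(w_{y,t}/w_{x,t}) if w_{x,t} > 0 and α_t = π/2 if w_{x,t} = 0. Assume K ∈ (1, 1.1], and initialize with v_0 = √(w_{x,0}² + w_{y,0}²) = ε ∈ (0, 0.10], w_{x,0} ≥ 0, w_{y,0} ≥ 0. Then, setting β = (1 + 1.1/π)·ε, there exists T₁ ≤ ⌈log_{2.56}(1.35/(π·β²))⌉ such that for all t ≥ T₁ + 4, w_{y,t}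 < 0.1·(1 − 0.030·K)^{t − T₁ − 4}. -/
open Real

/-- The quantity `γ = (1/π)(α − wₓ w_y / ‖w‖²)` where `α` is the angle of the student
neuron `w = (wₓ, w_y)` to the teacher: `α = arctan(w_y/wₓ)` if `wₓ > 0`, and `π/2` if
`wₓ = 0`. -/
noncomputable def neuronGamma (wx wy : ℝ) : ℝ :=
  (1 / Real.pi) * ((if 0 < wx then Real.arctan (wy / wx) else Real.pi / 2)
    - wx * wy / (wx ^ 2 + wy ^ 2))

/-- Bounds on `γ` in terms of `r = y/x` and `h = x y / (π n)`. -/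
lemma gamma_bounds (x y : ℝ) (hx : 0 < x) (hy : 0 ≤ y) :
    0 ≤ neuronGamma x y ∧ neuronGamma x y ≤ 1 / 2 - 2 * (x * y / (π * (x ^ 2 + y ^ 2))) ∧
    neuronGamma x y ≤ (y / x) ^ 2 * (x * y / (π * (x ^ 2 + y ^ 2))) := by
  have hpi := Real.pi_pos
  have hn : 0 < x ^ 2 + y ^ 2 := by positivity
  set θ := Real.arctan (y / x) with hθ
  have h0 : 0 ≤ θ := Real.arctan_nonneg.mpr (by positivity)
  have h1 : θ < π / 2 := Real.arctan_lt_pi_div_two _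
  have htan : Real.tan θ = y / x := Real.tan_arctan _
  have hcos : 0 < Real.cos θ := Real.cos_arctan_pos _
  have hsc : Real.sin θ * Real.cos θ = x * y / (x ^ 2 + y ^ 2) := by
    have e1 : Real.sin θ = y / x * Real.cos θ := by
      rw [← htan, Real.tan_mul_cos hcos.ne']
    have e2 := Real.sin_sq_add_cos_sq θ
    rw [e1] at e2 ⊢
    have e3 : Real.cos θ ^ 2 = x ^ 2 / (x ^ 2 + y ^ 2) := by
      field_simp at e2 ⊢
      linarith only [e2]
    calc y / x * Real.cos θ * Real.cos θ = y / x * Real.cos θ ^ 2 := by ring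
      _ = _ := by rw [e3]; field_simp
  have hg : neuronGamma x y = (1 / π) * (θ - x * y / (x ^ 2 + y ^ 2)) := by
    unfold neuronGamma; rw [if_pos hx]
  have hs1 : Real.sin θ * Real.cos θ ≤ θ := by
    have := Real.sin_le (x := 2 * θ) (by linarith only [h0])
    rw [Real.sin_two_mul] at this; linarith only [this]
  have hs2 : Real.sin θ * Real.cos θ ≤ π / 2 - θ := by
    have := Real.sin_le (x := π - 2 * θ) (by linarith only [h1])
    rw [Real.sin_pi_sub, Real.sin_two_mul] at this; linarith only [this]
  have hs3 : θ ≤ y / x := by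
    have := Real.le_tan h0 h1
    rwa [htan] at this
  rw [hsc] at hs1 hs2
  refine ⟨?_, ?_, ?_⟩
  · rw [hg]; apply mul_nonneg (by positivity); linarith only [hs1]
  · rw [hg]
    have : 1 / 2 - 2 * (x * y / (π * (x ^ 2 + y ^ 2))) =
      (1 / π) * (π / 2 - 2 * (x * y / (x ^ 2 + y ^ 2))) := by field_simp
    rw [this]
    apply mul_le_mul_of_nonneg_left _ (by positivity); linarith only [hs2]
  · rw [hg]
    have : (y / x) ^ 2 * (x * y / (π * (x ^ 2 + y ^ 2))) =
      (1 / π) * (y / x - x * y / (x ^ 2 + y ^ 2)) := by field_simp; ring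
    rw [this]
    apply mul_le_mul_of_nonneg_left _ (by positivity); linarith only [hs3]

lemma inv_pi_bounds : (0.3183 : ℝ) ≤ 1 / π ∧ 1 / π ≤ 0.31832 := by
  have h1 := Real.pi_gt_d6
  have h2 := Real.pi_lt_d6
  constructor
  · rw [le_div_iff₀ Real.pi_pos]; nlinarith only [h1, h2]
  · rw [div_le_iff₀ Real.pi_pos]; nlinarith only [h1, h2]

/-- One step in the scale-free coordinates `p = v/x`, `r = y/x`, `w = v x`. -/
lemma bridge (K v x y v' x' y' : ℝ) (hv : 0 < v) (hx : 0 < x) (hy : 0 ≤ y)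
    (h1 : v' = v + K * x * (1 - v * x - neuronGamma x y)
      + K * (y ^ 2 / v) * (-(v ^ 2) + v * y / (π * (x ^ 2 + y ^ 2))))
    (h2 : x' = x + K * v * (1 - v * x - neuronGamma x y))
    (h3 : y' = |y + K * y * (-(v ^ 2) + v * y / (π * (x ^ 2 + y ^ 2)))|) :
    ∃ p r w h g : ℝ, 0 < p ∧ 0 ≤ r ∧ v = p * x ∧ y = r * x ∧ w = p * x ^ 2 ∧ 0 < w ∧ 0 ≤ h ∧
      h ≤ 0.1592 ∧ 0.3183 * r ≤ h * (1 + r ^ 2) ∧ h * (1 + r ^ 2) ≤ 0.31832 * r ∧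
      0 ≤ g ∧ g ≤ 0.5 - 2 * h ∧ g ≤ r ^ 2 * h ∧
      x' = x * (1 + K * p * (1 - g - w)) ∧
      v' = x * (p + K * (1 - g - w) + K * r ^ 2 * (h - w)) ∧
      y' = |x * (r * (1 + K * p * (h - w)))| := by
  obtain ⟨g0, g1, g2⟩ := gamma_bounds x y hx hy
  obtain ⟨i1, i2⟩ := inv_pi_bounds
  have hn : 0 < x ^ 2 + y ^ 2 := by positivity
  have hpi := Real.pi_pos
  have hr : (0 : ℝ) ≤ y / x := by positivity
  have hh : x * y / (π * (x ^ 2 + y ^ 2)) * (1 + (y / x) ^ 2) = (1 / π) * (y / x) := by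
    field_simp
  have h0 : 0 ≤ x * y / (π * (x ^ 2 + y ^ 2)) := by positivity
  refine ⟨v / x, y / x, v * x, x * y / (π * (x ^ 2 + y ^ 2)), neuronGamma x y, by positivity,
    by positivity, by field_simp, by field_simp, by field_simp, by positivity, h0, ?_, ?_, ?_, g0,
    by linarith only [g1], g2, ?_, ?_, ?_⟩
  · have : x * y / (π * (x ^ 2 + y ^ 2)) ≤ (1 / π) * (1 / 2) := by
      rw [div_le_iff₀ (by positivity)]
      have : 1 / π * (1 / 2) * (π * (x ^ 2 + y ^ 2)) = (x ^ 2 + y ^ 2) / 2 := by field_simp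
      rw [this]; nlinarith only [sq_nonneg (x - y)]
    linarith only [i2, this]
  · rw [hh]; exact mul_le_mul_of_nonneg_right i1 hr
  · rw [hh]; exact mul_le_mul_of_nonneg_right i2 hr
  · rw [h2]; field_simp; ring
  · rw [h1]; field_simp; ring
  · rw [h3]; congr 1; field_simp; ring


lemma h_lower (r h R c : ℝ) (hr1 : 1 ≤ r) (hr : r ≤ R) (hh : 0.3183 * r ≤ h * (1 + r ^ 2))
    (hc : c * (1 + R ^ 2) ≤ 0.3183 * R) (hc0 : 0 ≤ c) (hc1 : 2 * c ≤ 0.3183)  : c ≤ h := by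
  have h1 : c * (1 + r ^ 2) ≤ 0.3183 * r := by
    nlinarith only [mul_nonneg hc0 (mul_nonneg (sub_nonneg.2 hr1) (sub_nonneg.2 hr)),
      mul_nonneg (sub_nonneg.2 hr1) (sub_nonneg.2 hr), mul_nonneg hc0 (sub_nonneg.2 hr),
      mul_nonneg (sub_nonneg.2 hc1) (sub_nonneg.2 hr1), mul_nonneg (sub_nonneg.2 hc) (sub_nonneg.2 hr1), hc, hr1, hr]
  nlinarith only [sq_nonneg r, hh, h1]

lemma lin_end (A B lo hi p : ℝ) (h1 : lo ≤ p) (h2 : p ≤ hi) (e1 : 0 ≤ A + B * lo)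
    (e2 : 0 ≤ A + B * hi) : 0 ≤ A + B * p := by
  rcases le_total 0 B with hB | hB
  · nlinarith only [e1, h1, hB]
  · nlinarith only [e2, h2, hB]

set_option maxHeartbeats 2000000 in
lemma step1 (K p r w h g : ℝ) (hK1 : 1 ≤ K) (hK2 : K ≤ 1.1) (hp1 : 0.95 ≤ p) (hp2 : p ≤ 2.65)
    (hr0 : 0 ≤ r) (hr2 : r ≤ 2.65) (hrp : 0.98 * r ≤ p) (hw0 : 0 < w) (hwp : w * p ≤ 0.0441)
    (h0 : 0 ≤ h) (h1 : h ≤ 0.1592) (hl : 0.3183 * r ≤ h * (1 + r ^ 2))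
    (hu : h * (1 + r ^ 2) ≤ 0.31832 * r) (g0 : 0 ≤ g) (g1 : g ≤ 0.5 - 2 * h) (g2 : g ≤ r ^ 2 * h) :
    0.68 ≤ 1 - g - w ∧
    r * (1 + K * p * (h - w)) ≤ 1.21 * (1 + K * p * (1 - g - w)) ∧
    0.93 * (1 + K * p * (1 - g - w)) ≤ p + K * (1 - g - w) + K * r ^ 2 * (h - w) ∧
    p + K * (1 - g - w) + K * r ^ 2 * (h - w) ≤ 1.47 * (1 + K * p * (1 - g - w)) ∧
    1.32 * p ≤ p + K * (1 - g - w) + K * r ^ 2 * (h - w) := by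
  have hw1 : w ≤ 0.0465 := by nlinarith only [hw0, hwp, hp1]
  have hpp : 0 < p := by linarith only [hp1, hw0, hw1]
  have ha : 0.68 ≤ 1 - g - w := by
    rcases le_total r 1 with hr1 | hr1
    · have : r ^ 2 * h ≤ h := by nlinarith only [mul_nonneg hr0 h0, hw0, h0, hr1, hw1, hr0]
      linarith only [hw0, h1, g2, hw1, this]
    · rcases le_total r 2 with hr3 | hr3
      · have := h_lower r h 2 0.1273 hr1 hr3 hl (by norm_num) (by norm_num) (by norm_num)
        linarith only [hw0, g1, hw1, this]
      · have := h_lower r h 2.65 0.105 hr1 hr2 hl (by norm_num) (by norm_num) (by norm_num)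
        have : w ≤ 0.0226 := by nlinarith only [hrp, hw0, hwp, hr3, hp1]
        linarith
  have ha1 : 1 - g - w ≤ 1 := by linarith only [hw0, g0]
  have hrw : -0.0041 ≤ r ^ 2 * (h - w) := by
    rcases le_total w h with hc | hc
    · have : 0 ≤ r ^ 2 * (h - w) := mul_nonneg (sq_nonneg r) (by linarith only [hc])
      linarith only [hw0, hw1, this]
    · have hr1 : r ≤ 1 := by
        by_contra hcon
        push Not at hcon
        have := h_lower r h 2.65 0.105 hcon.le hr2 hl (by norm_num) (by norm_num) (by norm_num)
        linarith only [hw0, hw1, hc, this]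
      have : h * (1 + r ^ 2) ≤ 0.0465 * 2 := by
        apply mul_le_mul <;> nlinarith only [hw1, hc, hw0, hwp, hl, hp1, hr0, hr2]
      have hr3 : r ≤ 0.2922 := by linarith only [hw0, hl, hw1, this]
      have hr4 : r ^ 2 ≤ 0.0854 := by nlinarith only [hl, this, hr0]
      nlinarith only [mul_nonneg (sq_nonneg r) h0, mul_nonneg (sub_nonneg.2 hr4) hw0.le, hw0, g0, g2, hw1, hr4]
  have hKp : p ≤ K * p := by nlinarith only [hK1, hp1]
  have hKp0 : 0 ≤ K * p := by positivity
  generalize hA : 1 - g - w = a at *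
  refine ⟨ha, ?_, ?_, ?_, ?_⟩
  · rcases le_total r 1.21 with hr1 | hr1
    · have e1 : r * (h - w) ≤ 1.21 * a := by
        have : r * (h - w) ≤ r * h := by nlinarith only [hr0, hw0]
        have : r * h ≤ 1.21 * 0.1592 := mul_le_mul hr1 h1 h0 (by norm_num)
        nlinarith
      nlinarith only [mul_le_mul_of_nonneg_left e1 hKp0, hr1, e1, hKp0]
    · have e1 : 0.568 ≤ 1.21 * a - r * (h - w) := by
        have q1 : 0 ≤ w * (r - 1.21) := mul_nonneg hw0.le (by linarith only [hr1])
        have q2 : 0 ≤ h * (2.65 - r) := mul_nonneg h0 (by linarith only [hr2])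
        linarith only [hw0, h1, g1, hw1, hA, q1, q2]
      have e2 := mul_le_mul_of_nonneg_left e1 hKp0
      have e3 : K * p * (1.21 * a - r * (h - w)) = 1.21 * (1 + K * p * a) - r * (1 + K * p * (h - w)) - 1.21 + r := by ring
      linarith only [hp2, hrp, hw0, hw1, hKp, e2]
  · have e1 : -0.00451 ≤ K * (r ^ 2 * (h - w)) := by nlinarith only [hK2, hrw, hK1]
    have e2 : 0 ≤ p - 0.93 + K * a * (1 - 0.93 * p) - 0.00451 := by
      have b1 : 0.68 ≤ K * a := by nlinarith only [hK1, ha, h0, g1, hw1, hA]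
      have b2 : K * a ≤ 1.1 := by nlinarith only [hK2, hw0, g0, hA, hK1]
      generalize K * a = z at *
      nlinarith only [mul_nonneg (sub_nonneg.2 hp1) (sub_nonneg.2 b2), mul_nonneg (sub_nonneg.2 hp2) (sub_nonneg.2 b1), hp2, hw0, hw1, b1, hp1, b2]
    nlinarith only [e1, e2]
  · have hr3 : r ^ 2 * h ≤ 0.2787 * r := by
      have q1 : h * (1 + r ^ 2) ≤ h * 8.0225 := by
        apply mul_le_mul_of_nonneg_left _ h0
        have : r ^ 2 ≤ 2.65 ^ 2 := pow_le_pow_left₀ hr0 hr2 2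
        linarith only [this]
      linarith only [hr0, hu, q1]
    have hb : 0 ≤ 1.47 * p - 1 := by linarith only [hp1, hw0, hw1]
    have e1 : K * 0.68 * (1.47 * p - 1) ≤ K * a * (1.47 * p - 1) := by
      apply mul_le_mul_of_nonneg_right _ hb
      exact mul_le_mul_of_nonneg_left ha (by linarith only [hK1, hw0, hw1])
    have e2 : K * (r ^ 2 * (h - w)) ≤ K * (0.2787 * r) := by
      apply mul_le_mul_of_nonneg_left _ (by linarith only [hK1, hw0, hw1])
      have := mul_nonneg (sq_nonneg r) hw0.le
      linarith only [hr3, this]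
    have e3 : 0 ≤ (K - 1) * (0.9996 * p - 0.68 - 0.2787 * r + 0.001) := mul_nonneg (by linarith only [hK1]) (by linarith only [hp1, hrp, hw0, hw1])
    linarith only [hK2, hp2, hr2, hw0, hw1, e1, e2, e3]
  · have e0 : 1 - w - r ^ 2 * w ≤ a + r ^ 2 * (h - w) := by linarith only [g2, hA]
    have e1 : r ^ 2 * w ≤ 0.046 * p := by
      have q0 : r ^ 2 ≤ (p / 0.98) ^ 2 := pow_le_pow_left₀ hr0 (by rw [le_div_iff₀ (by norm_num)]; linarith only [hrp]) 2
      have q1 : r ^ 2 * w ≤ (p / 0.98) ^ 2 * w := mul_le_mul_of_nonneg_right q0 hw0.le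
      have q2 : p * (w * p) ≤ p * 0.0441 := mul_le_mul_of_nonneg_left hwp hpp.le
      have q3 : (p / 0.98) ^ 2 * w = p * (w * p) / 0.98 ^ 2 := by ring
      rw [q3] at q1
      have q4 : p * (w * p) / 0.98 ^ 2 ≤ p * 0.0441 / 0.98 ^ 2 := div_le_div_of_nonneg_right q2 (by norm_num)
      have q5 : p * 0.0441 / 0.98 ^ 2 ≤ 0.046 * p := by rw [div_le_iff₀ (by norm_num)]; norm_num; linarith only [hp1, hw0, hw1]
      linarith only [q1, q4, q5]
    have e2 : 0.32 * p ≤ a + r ^ 2 * (h - w) := by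
      rcases le_total p 2.2 with hc | hc
      · linarith only [hw0, g2, hw1, hA, e1, hc]
      · have q : w * 2.2 ≤ w * p := mul_le_mul_of_nonneg_left hc hw0.le
        linarith only [hp2, hw0, hwp, g2, hA, e1, q]
    have e3 : 1 * (a + r ^ 2 * (h - w)) ≤ K * (a + r ^ 2 * (h - w)) :=
      mul_le_mul_of_nonneg_right hK1 (by linarith only [hw0, h0, g1, hw1, hrw, hA])
    linarith only [e2, e3]

set_option maxHeartbeats 2000000 in
lemma step2 (K p r w h g : ℝ) (hK1 : 1 ≤ K) (hK2 : K ≤ 1.1) (hp1 : 0.93 ≤ p) (hp2 : p ≤ 1.47)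
    (hr0 : 0 ≤ r) (hr2 : r ≤ 1.21) (hw0 : 0 < w) (hw1 : w ≤ 0.207) (hwp : w ≤ 0.2025 * p)
    (h0 : 0 ≤ h) (h1 : h ≤ 0.1592) (hl : 0.3183 * r ≤ h * (1 + r ^ 2))
    (g0 : 0 ≤ g) (g1 : g ≤ 0.5 - 2 * h) (g2 : g ≤ r ^ 2 * h) :
    0.6 ≤ 1 - g - w ∧
    r * (1 + K * p * (h - w)) ≤ 0.8 * (1 + K * p * (1 - g - w)) ∧
    0.94 * (1 + K * p * (1 - g - w)) ≤ p + K * (1 - g - w) + K * r ^ 2 * (h - w) ∧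
    p + K * (1 - g - w) + K * r ^ 2 * (h - w) ≤ 1.15 * (1 + K * p * (1 - g - w)) := by
  have hpp : 0 < p := by linarith only [hw0, hwp]
  have hcase : (r ≤ 1 ∧ r ^ 2 * h ≤ 0.1592 * r ^ 2 ∧ r ^ 2 ≤ 1) ∨ (1 ≤ r ∧ 0.1562 ≤ h) := by
    rcases le_total r 1 with hr1 | hr1
    · left; exact ⟨hr1, by nlinarith only [sq_nonneg r, h1], by nlinarith only [hr1, hr0]⟩
    · right; exact ⟨hr1, h_lower r h 1.21 0.1562 hr1 hr2 hl (by norm_num) (by norm_num) (by norm_num)⟩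
  have ha : 0.6 ≤ 1 - g - w := by
    rcases hcase with ⟨a1, a2, a3⟩ | ⟨a1, a2⟩ <;> linarith
  have hr3 : r ^ 2 ≤ 1.4641 := by nlinarith only [hr2, hr0]
  have hKp : p ≤ K * p := by nlinarith only [hK1, hp1]
  have hKp0 : 0 ≤ K * p := by positivity
  refine ⟨ha, ?_, ?_, ?_⟩
  · have e1 : r - 0.8 ≤ 0.93 * (0.8 * (1 - g - w) - r * (h - w)) := by
      rcases hcase with ⟨a1, a2, a3⟩ | ⟨a1, a2⟩
      · have b1 : g ≤ 0.1592 := by linarith only [g2, a2, a3]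
        have b2 : r * h ≤ 0.1592 * r := by nlinarith only [hr0, h1]
        nlinarith only [mul_nonneg (sub_nonneg.2 a1) (sub_nonneg.2 hw1), mul_nonneg hr0 hw0.le, hr2, hw0, ha, a1, b2, hw1]
      · have : 0 ≤ w * (r - 0.8) := mul_nonneg hw0.le (by linarith only [hw0, hw1, a1])
        have : r * h ≤ 1.21 * h := mul_le_mul_of_nonneg_right hr2 h0
        nlinarith
    have e2 : 0 ≤ (0.8 * (1 - g - w) - r * (h - w)) := by
      have : r * h ≤ 1.21 * 0.1592 := mul_le_mul hr2 h1 h0 (by norm_num)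
      nlinarith only [mul_nonneg hr0 hw0.le, hw0, hw1, h0, g1, this, hr0]
    nlinarith only [mul_le_mul_of_nonneg_right (hp1.trans hKp) e2, e1, hp1, hKp, e2]
  · have hs0 : 0 ≤ r ^ 2 := sq_nonneg r
    have e1 : r ^ 2 * (w - h) ≤ max 0 (1.4641 * (w - 0.1562)) ∨ r ^ 2 * (w - h) ≤ r ^ 2 * (w - 0.159 * r) := by
      rcases hcase with ⟨a1, a2, a3⟩ | ⟨a1, a2⟩
      · right
        apply mul_le_mul_of_nonneg_left _ hs0
        nlinarith only [hl, a2, a3, hr0, hr2, a1]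
      · left
        rcases le_total w 0.1562 with hc | hc
        · apply le_max_of_le_left
          nlinarith only [a2, hc]
        · apply le_max_of_le_right
          apply (mul_le_mul_of_nonneg_left (by linarith only [a2] : w - h ≤ w - 0.1562) hs0).trans
          apply mul_le_mul_of_nonneg_right hr3; linarith only [hc]
    have e2 : r ^ 2 * (w - h) ≤ 0.0521 ∨ (r ^ 2 * (w - h) ≤ 0.0744 ∧ r ^ 2 * (w - h) ≤ 0.2965 * p - 0.2287) := by
      rcases e1 with e1 | e1
      · rcases le_max_iff.1 e1 with e1 | e1
        · left; linarith only [hw0, hw1, e1]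
        · right; constructor <;> linarith only [hw0, hw1, e1, hp1, hwp]
      · left
        have : r ^ 2 * w ≤ r ^ 2 * 0.207 := mul_le_mul_of_nonneg_left hw1 hs0
        have : 0 ≤ (r - 0.868) ^ 2 * (r + 0.434) := by positivity
        nlinarith
    have e3 : K * r ^ 2 * (h - w) = -(K * (r ^ 2 * (w - h))) := by ring
    rw [e3]
    generalize r ^ 2 * (w - h) = D at *
    have hD : D ≤ 0.0744 := by rcases e2 with e2 | ⟨e2, _⟩ <;> linarith only [hw0, hw1, e2]
    have ha1 : 1 - g - w ≤ 1 := by linarith only [hw0, g0]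
    generalize 1 - g - w = a at *
    have b2 : K * a ≤ 1.1 := by nlinarith only [hK2, ha1, hK1]
    have b3 : K * D ≤ 0.0819 := by nlinarith only [hK2, hw0, hw1, hD, hK1]
    rcases le_total p (1 / 0.94) with hc | hc
    · have b1 : 0 ≤ 1 - 0.94 * p := by norm_num at hc ⊢; linarith only [hc]
      have b4 : K * 0.6 * (1 - 0.94 * p) ≤ K * a * (1 - 0.94 * p) := by
        apply mul_le_mul_of_nonneg_right _ b1
        nlinarith only [ha, hK1]
      have b5 : 0 ≤ (p - 0.94) + (0.6 - 0.564 * p - D) * K := by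
        apply lin_end _ _ 1 1.1 K hK1 hK2
        · rcases e2 with e2 | ⟨_, e2⟩
          · linarith only [hp1, hw0, hwp, e2]
          · linarith only [hp1, hw0, hw1, e2]
        · rcases e2 with e2 | ⟨_, e2⟩
          · linarith only [hp1, hw0, hwp, e2]
          · linarith only [hp1, hw0, hw1, e2]
      linarith only [b4, b5]
    · have b1 : 0 ≤ 0.94 * p - 1 := by norm_num at hc ⊢; linarith only [hc]
      have b4 : K * a * (0.94 * p - 1) ≤ 1.1 * (0.94 * p - 1) := mul_le_mul_of_nonneg_right b2 b1
      linarith only [hp2, hw0, hw1, b3, b4]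
  · have hs0 : 0 ≤ r ^ 2 := sq_nonneg r
    have n1 : r ^ 2 * (h - w) ≤ 0.2331 := by
      have : r ^ 2 * h ≤ 1.4641 * 0.1592 := mul_le_mul hr3 h1 h0 (by norm_num)
      have : 0 ≤ r ^ 2 * w := mul_nonneg hs0 hw0.le
      linarith
    have n2 : 0.32 ≤ 0.6905 * (1 - g - w) - r ^ 2 * (h - w) := by
      rcases hcase with ⟨a1, a2, a3⟩ | ⟨a1, a2⟩
      · have : 0 ≤ (1 - r ^ 2) * (0.2694 - w) := mul_nonneg (by linarith only [a3]) (by linarith only [hw0, hw1])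
        linarith only [hr0, hw0, hw1, hl, g1, g2, a2, this]
      · have : 0 ≤ (r ^ 2 - 1) * w := mul_nonneg (by nlinarith only [a1, hr0]) hw0.le
        have : r ^ 2 * h ≤ 1.4641 * h := mul_le_mul_of_nonneg_right hr3 h0
        linarith
    have key : 0 ≤ (1.15 - K * (1 - g - w) - K * (r ^ 2 * (h - w))) + (1.15 * K * (1 - g - w) - 1) * p := by
      generalize r ^ 2 * (h - w) = D at *
      generalize 1 - g - w = a at *
      apply lin_end _ _ 0.93 1.47 p hp1 hp2
      · nlinarith only [hK2, hw0, hw1, n1, n2, hK1, ha]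
      · nlinarith only [hK1, n2, n1, ha]
    linarith only [key]

set_option maxHeartbeats 2000000 in
lemma stepR (K p r s w h g : ℝ) (hK1 : 1 ≤ K) (hK2 : K ≤ 1.1) (hp1 : 0.94 ≤ p) (hp2 : p ≤ 1.15)
    (hr0 : 0 ≤ r) (hr2 : r ≤ 0.8) (hs0 : 0 < s) (hs1 : s ≤ 0.2401) (hws : w = p * s)
    (hrs : r ^ 2 * s ≤ 0.0625)
    (h0 : 0 ≤ h) (h1 : h ≤ 0.1592) (hl : 0.3183 * r ≤ h * (1 + r ^ 2))
    (g0 : 0 ≤ g) (g2 : g ≤ r ^ 2 * h) :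
    0.68 ≤ K * p * (1 - g - w) ∧
    0 ≤ 1 + K * p * (h - w) ∧
    r * (1 + K * p * (h - w)) ≤ 0.51 * (1 + K * p * (1 - g - w)) ∧
    0.96 * (1 + K * p * (1 - g - w)) ≤ p + K * (1 - g - w) + K * r ^ 2 * (h - w) ∧
    p + K * (1 - g - w) + K * r ^ 2 * (h - w) ≤ 1.07 * (1 + K * p * (1 - g - w)) := by
  have hpp : 0 < p := by linarith only [hp1, hs0, hs1]
  have hq0 : 0 ≤ r ^ 2 := sq_nonneg r
  have hq1 : r ^ 2 ≤ 0.64 := by nlinarith only [hr2, hr0]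
  have hw0 : 0 < w := by rw [hws]; positivity
  have hw1 : w ≤ 0.2762 := by
    have : p * s ≤ 1.15 * 0.2401 := mul_le_mul hp2 hs1 hs0.le (by norm_num)
    linarith only [hs0, hs1, hws, this]
  have u1 : r ^ 2 * h ≤ 0.102 := by
    have : r ^ 2 * h ≤ 0.64 * 0.1592 := mul_le_mul hq1 h1 h0 (by norm_num)
    linarith only [hs0, hs1, this]
  have u2 : r ^ 2 * h ≤ r ^ 2 * 0.1592 := mul_le_mul_of_nonneg_left h1 hq0
  have hg1 : g ≤ 0.102 := by linarith only [g2, u1]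
  have hgs : g * s ≤ 0.00995 := by
    have q1 : g * s ≤ r ^ 2 * 0.1592 * s := mul_le_mul_of_nonneg_right (by linarith only [g2, u2]) hs0.le
    linarith only [hrs, q1]
  have hgs2 : g + 0.94 * s ≤ 0.2757 ∧ g + 1.15 * s ≤ 0.35 := by
    rcases le_total s 0.17 with hc | hc
    · constructor <;> linarith only [hs0, g2, u1, hc]
    · have q1 : g * 0.17 ≤ g * s := mul_le_mul_of_nonneg_left hc g0
      rcases le_total s 0.2 with hd | hd
      · constructor <;> linarith only [hs0, hgs, q1, hd, g2, u1]
      · have q2 : g * 0.2 ≤ g * s := mul_le_mul_of_nonneg_left hd g0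
        constructor <;> linarith only [hs0, hs1, hgs, q2, q1]
  have hpa : 0.68 ≤ p * (1 - g - w) := by
    have q1 : 0 ≤ (p - 0.94) * (1.15 - p) * s :=
      mul_nonneg (mul_nonneg (by linarith only [hp1]) (by linarith only [hp2])) hs0.le
    have q2 : 0 ≤ (1.081 * s - 0.68) + (1 - g - 2.09 * s) * p := by
      apply lin_end _ _ 0.94 1.15 p hp1 hp2
      · linarith only [hgs2.1, hs0, hs1, hgs2]
      · linarith only [hgs2.2, hs0, hs1, g2, u1]
    rw [hws]; linarith only [q1, q2]
  have ha : 0.59 ≤ 1 - g - w := by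
    have : 0 < 1 - g - w := by linarith only [hs0, hs1, g2, hw1, u1]
    have : p * (1 - g - w) ≤ 1.15 * (1 - g - w) := mul_le_mul_of_nonneg_right hp2 this.le
    linarith only [hs0, hs1, g2, hw1, u1]
  have ha1 : 1 - g - w ≤ 1 := by linarith only [g0, hw0]
  have hKp : p ≤ K * p := by nlinarith only [hK1, hp1]
  have hKp2 : K * p ≤ 1.265 := by nlinarith only [hK2, hp2, hK1]
  have hKp0 : 0 ≤ K * p := by positivity
  refine ⟨?_, ?_, ?_, ?_, ?_⟩
  · have : p * (1 - g - w) ≤ K * p * (1 - g - w) := mul_le_mul_of_nonneg_right hKp (by linarith only [hs0, hs1, g2, hw1, u1])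
    linarith only [hpa, this]
  · have q1 : K * p * w ≤ 1.265 * 0.2762 := mul_le_mul hKp2 hw1 hw0.le (by norm_num)
    have q2 : 0 ≤ K * p * h := mul_nonneg hKp0 h0
    linarith only [hs0, hs1, q1, q2]
  · have e0 : r * h ≤ r * 0.1592 := mul_le_mul_of_nonneg_left h1 hr0
    have e4 : 0 ≤ r * w := mul_nonneg hr0 hw0.le
    have e2 : 0 ≤ 0.51 * (1 - g - w) - r * (h - w) := by linarith only [hr2, hs0, hs1, g2, hw1, u1, e0, e4]
    have e1 : r - 0.51 ≤ 0.94 * (0.51 * (1 - g - w) - r * (h - w)) := by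
      rcases le_total r 0.51 with hc | hc
      · linarith only [hs0, hs1, g2, hq1, hw1, u2, e0, e4, hc]
      · have : 0 ≤ (r - 0.51) * w := mul_nonneg (by linarith only [hc]) hw0.le
        linarith only [hr2, hs0, hs1, g2, hq1, u2, e0, this]
    have e3 := mul_le_mul_of_nonneg_right (hp1.trans hKp) e2
    linarith only [e1, e3]
  · have hD : r ^ 2 * (w - h) ≤ 0.0625 * p - 0.0205 := by
      have d1 : r ^ 2 * (0.159 * r) ≤ r ^ 2 * h := by
        apply mul_le_mul_of_nonneg_left _ hq0
        have : h * (1 + r ^ 2) ≤ h * 2 := mul_le_mul_of_nonneg_left (by linarith only [hs0, hs1, hq1]) h0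
        linarith only [h0, hl, this]
      rcases le_total r 0.51 with hc | hc
      · have d2 : r ^ 2 * w ≤ r ^ 2 * (0.2401 * p) := by
          apply mul_le_mul_of_nonneg_left _ hq0
          have := mul_le_mul_of_nonneg_left hs1 hpp.le
          rw [hws]; linarith only [this]
        have d3 : r ^ 2 ≤ 0.2601 := by
          have := pow_le_pow_left₀ hr0 hc 2
          linarith only [this]
        have d4 : 0 ≤ (p - 0.94) * (0.0625 - 0.2401 * r ^ 2) := mul_nonneg (by linarith only [hp1]) (by linarith only [hs0, hs1, d3])
        have d5 : 0 ≤ 0.05875 - 0.225694 * r ^ 2 + 0.159 * r ^ 3 - 0.0205 := by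
          have : 0 ≤ (0.51 - r) * (0.51 + r) := mul_nonneg (by linarith only [hc]) (by linarith only [hr0, hs0, hs1])
          have : 0 ≤ (0.51 - r) ^ 2 * (r + 1.02) := by positivity
          clear * - hr0 hr2 hc d3 this
          nlinarith only [d3, this, hr0]
        linarith only [d1, d2, d4, d5]
      · have d2 : r ^ 2 * w ≤ 0.0625 * p := by
          have := mul_le_mul_of_nonneg_left hrs hpp.le
          rw [hws]; linarith only [this]
        have d3 : 0.51 ^ 3 ≤ r ^ 3 := pow_le_pow_left₀ (by norm_num) hc 3
        norm_num at d3
        linarith only [hs0, hs1, d1, d2, d3]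
    have e3 : K * r ^ 2 * (h - w) = -(K * (r ^ 2 * (w - h))) := by ring
    rw [e3]
    have hKD : K * (r ^ 2 * (w - h)) ≤ K * (0.0625 * p - 0.0205) :=
      mul_le_mul_of_nonneg_left hD (by linarith only [hK1, hs0, hs1])
    have b2 : K * (1 - g - w) ≤ 1.1 := by nlinarith only [hK2, g0, hw0, hK1]
    rcases le_total p (1 / 0.96) with hc | hc
    · have b1 : 0 ≤ 1 - 0.96 * p := by norm_num at hc ⊢; linarith only [hc]
      have a2 : 0.652 ≤ 1 - g - w := by
        have : p * (1 - g - w) ≤ 1 / 0.96 * (1 - g - w) := mul_le_mul_of_nonneg_right hc (by linarith only [hs0, hs1, g2, hw1, u1])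
        norm_num at this ⊢
        linarith only [hpa, this]
      have b4 : K * 0.652 * (1 - 0.96 * p) ≤ K * (1 - g - w) * (1 - 0.96 * p) := by
        apply mul_le_mul_of_nonneg_right _ b1
        exact mul_le_mul_of_nonneg_left a2 (by linarith only [hK1, hs0, hs1])
      have b5 : 0 ≤ (p - 0.96) + (0.652 - 0.62592 * p - (0.0625 * p - 0.0205)) * K := by
        apply lin_end _ _ 1 1.1 K hK1 hK2 <;> linarith only [hp1, hs0, hs1]
      linarith only [hKD, b4, b5]
    · have b1 : 0 ≤ 0.96 * p - 1 := by norm_num at hc ⊢; linarith only [hc]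
      have b4 : K * (1 - g - w) * (0.96 * p - 1) ≤ 1.1 * (0.96 * p - 1) := mul_le_mul_of_nonneg_right b2 b1
      have b5 : K * (0.0625 * p - 0.0205) ≤ 1.1 * (0.0625 * p - 0.0205) := mul_le_mul_of_nonneg_right hK2 (by linarith only [hs0, hs1, hc])
      linarith only [hK1, hp2, hs0, hs1, hKp2, hKD, b4]
  · have n1 : r ^ 2 * (h - w) ≤ 0.102 := by
      have : 0 ≤ r ^ 2 * w := mul_nonneg hq0 hw0.le
      linarith only [u1, this]
    have n2 : 0.08 ≤ 0.2305 * (1 - g - w) - r ^ 2 * (h - w) := by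
      rcases le_total (r ^ 2) 0.2305 with hc | hc
      · have : 0 ≤ (0.2305 - r ^ 2) * (0.2762 - w) := mul_nonneg (by linarith only [hc]) (by linarith only [hw1])
        linarith only [hs0, hs1, g2, hq0, u2, this]
      · have : 0 ≤ (r ^ 2 - 0.2305) * w := mul_nonneg (by linarith only [hc]) hw0.le
        linarith only [hs0, hs1, g2, hq1, u2, this]
    have key : 0 ≤ (1.07 - K * (1 - g - w) - K * (r ^ 2 * (h - w))) + (1.07 * K * (1 - g - w) - 1) * p := by
      generalize r ^ 2 * (h - w) = D at *
      generalize 1 - g - w = a at *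
      have k0 : 0 ≤ K * a := mul_nonneg (by linarith only [hK1, hs0, hs1]) (by linarith only [hs0, hs1, ha])
      have k1 : K * D ≤ K * 0.102 := mul_le_mul_of_nonneg_left n1 (by linarith only [hK1, hs0, hs1])
      have k2 := mul_le_mul_of_nonneg_left n2 (by linarith only [hK1, hs0, hs1] : 0 ≤ K)
      clear * - k0 k1 k2 hK1 hK2 hp1 hp2
      apply lin_end _ _ 0.94 1.15 p hp1 hp2
      · linarith only [hK2, k1, k2]
      · linarith only [hK1, k2]
    linarith only [key]

lemma stepR_y (K p r x w h : ℝ) (hK1 : 1 ≤ K) (hK2 : K ≤ 1.1) (hp1 : 0.94 ≤ p) (hp2 : p ≤ 1.15)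
    (hr0 : 0 ≤ r) (hr2 : r ≤ 0.8) (hx0 : 0 < x) (hws : w = p * x ^ 2)
    (hrx : r * x ≤ 0.25) (h1 : h ≤ 0.1592) (hn : 0 ≤ 1 + K * p * (h - w)) :
    |x * (r * (1 + K * p * (h - w)))| ≤ 0.27 := by
  rw [abs_of_nonneg (mul_nonneg hx0.le (mul_nonneg hr0 hn))]
  have hKp2 : K * p ≤ 1.265 := by nlinarith only [hK2, hp2, hK1]
  have hKp0 : 0 ≤ K * p := by nlinarith only [hK1, hp1]
  have hy0 : 0 ≤ x * r := mul_nonneg hx0.le hr0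
  have hw0 : 0 < w := by rw [hws]; have : 0 < p := by linarith only [hp1]
                         positivity
  have e : x * (r * (1 + K * p * (h - w))) = (x * r) * (1 + K * p * (h - w)) := by ring
  rw [e]
  rcases le_total x 0.28 with hc | hc
  · have a1 : x * r ≤ 0.28 * 0.8 := mul_le_mul hc hr2 hr0 (by norm_num)
    have a2 : 1 + K * p * (h - w) ≤ 1.2014 := by nlinarith only [hK2, hp2, hK1, hx0, hc, h1, hKp0, hn, hw0]
    have := mul_le_mul a1 a2 hn (by norm_num)
    linarith only [hx0, hc, this]
  · rcases le_total x 0.3 with hd | hd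
    · have a1 : x * r ≤ 0.3 * 0.8 := mul_le_mul hd hr2 hr0 (by norm_num)
      have x2 : 0.0784 ≤ x ^ 2 := by nlinarith only [hc, hx0]
      have w1 : 0.0736 ≤ w := by rw [hws]; nlinarith only [x2, hp1]
      have a2 : 1 + K * p * (h - w) ≤ 1.11 := by nlinarith only [hK2, hp2, hK1, hx0, hd, h1, hKp0, hn, w1]
      have := mul_le_mul a1 a2 hn (by norm_num)
      linarith only [hx0, hd, this]
    · have x2 : 0.09 ≤ x ^ 2 := by nlinarith only [hd, hx0]
      have w1 : 0.09 * p ≤ w := by rw [hws]; nlinarith only [x2, hp1]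
      have a0 : p * (h - w) ≤ 0.0702 := by
        have : p * (h - w) ≤ p * (0.1592 - 0.09 * p) := mul_le_mul_of_nonneg_left (by linarith only [h1, w1]) (by linarith only [hp1])
        nlinarith only [hp1, this]
      have a2 : 1 + K * p * (h - w) ≤ 1.0773 := by nlinarith only [hK2, a0, hK1]
      have := mul_le_mul (by linarith only [hrx] : x * r ≤ 0.25) a2 hn (by norm_num)
      linarith only [this]

lemma stepR_x (K p x w g : ℝ) (hK1 : 1 ≤ K) (hK2 : K ≤ 1.1) (hp1 : 0.94 ≤ p) (hp2 : p ≤ 1.15)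
    (hx0 : 0 < x) (hx : x ≤ 0.49) (hws : w = p * x ^ 2) (g0 : 0 ≤ g) :
    x * (1 + K * p * (1 - g - w)) ≤ 0.943 := by
  have x2 : x ^ 2 ≤ 0.2401 := by nlinarith only [hx, hx0]
  have a1 : p * (1 - w) ≤ 1.15 * (1 - 1.15 * x ^ 2) := by
    rw [hws]
    have : 0 ≤ (1.15 - p) * (1 - (p + 1.15) * x ^ 2) := by
      apply mul_nonneg (by linarith only [hp2])
      nlinarith only [sq_nonneg x, hx0, hx, x2, hp2]
    linarith only [this]
  have a2 : K * p * (1 - g - w) ≤ 1.265 * (1 - 1.15 * x ^ 2) := by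
    have b1 : p * (1 - g - w) ≤ p * (1 - w) := mul_le_mul_of_nonneg_left (by linarith only [g0]) (by linarith only [hp1, hx0, hx])
    have b2 : K * (p * (1 - g - w)) ≤ K * (1.15 * (1 - 1.15 * x ^ 2)) :=
      mul_le_mul_of_nonneg_left (b1.trans a1) (by linarith only [hK1, hx0, hx])
    have b3 : K * (1.15 * (1 - 1.15 * x ^ 2)) ≤ 1.1 * (1.15 * (1 - 1.15 * x ^ 2)) :=
      mul_le_mul_of_nonneg_right hK2 (by linarith only [hx0, hx, x2])
    linarith only [b2, b3]
  have a3 : x * (1 + K * p * (1 - g - w)) ≤ x * (1 + 1.265 * (1 - 1.15 * x ^ 2)) :=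
    mul_le_mul_of_nonneg_left (by linarith only [a2]) hx0.le
  have a4 : 0 ≤ (0.49 - x) * (0.2401 - x ^ 2) := mul_nonneg (by linarith only [hx]) (by linarith only [x2])
  nlinarith [mul_nonneg hx0.le (by linarith only [hx] : 0 ≤ 0.49 - x)]


/-- Difference of squares after one step. -/
lemma q_upper (K v x y a w e : ℝ) (hK1 : 1 ≤ K) (hK2 : K ≤ 1.1) (hv : 0 < v) (hx : 0 < x)
    (hw : w = v * x) (ha : a ≤ 1 - w) (hKa : K ^ 2 * a ^ 2 ≤ 0.8) (hva : 0 ≤ v + K * x * a)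
    (hy : y ^ 2 ≤ 0.0730) (he1 : -(K * y ^ 2 * v) ≤ e) :
    (x + K * v * a) ^ 2 - (v + K * x * a + e) ^ 2 ≤ max (x ^ 2 - v ^ 2) 0 + 2.205 * y ^ 2 := by
  have id1 : (x + K * v * a) ^ 2 - (v + K * x * a + e) ^ 2 =
      (x ^ 2 - v ^ 2) * (1 - K ^ 2 * a ^ 2) - 2 * e * (v + K * x * a) - e ^ 2 := by ring
  have i2 : -2 * e * (v + K * x * a) ≤ 2 * (K * y ^ 2 * v) * (v + K * x * a) :=
    mul_le_mul_of_nonneg_right (by linarith only [he1]) hva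
  have hw0 : 0 < w := by rw [hw]; positivity
  have i3 : 2 * K * (K * (w * a) + w) ≤ 2.205 := by
    have : w * a ≤ w * (1 - w) := mul_le_mul_of_nonneg_left ha hw0.le
    have : K * (w * a) ≤ K * (w * (1 - w)) := mul_le_mul_of_nonneg_left this (by linarith only [hK1])
    have : 2 * K * (K * (w * a) + w) ≤ 2 * K * (K * (w * (1 - w)) + w) :=
      mul_le_mul_of_nonneg_left (by linarith only [this]) (by linarith only [hK1])
    nlinarith only [sq_nonneg (2 * K * w - (1 + K)), hK2, this, hK1]
  have i4 : 2 * (K * y ^ 2 * v) * (v + K * x * a) =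
      y ^ 2 * (2 * K * (K * (w * a) + w)) + 2 * K * y ^ 2 * (v ^ 2 - v * x) := by rw [hw]; ring
  have hy0 := sq_nonneg y
  have i5 : y ^ 2 * (2 * K * (K * (w * a) + w)) ≤ y ^ 2 * 2.205 := mul_le_mul_of_nonneg_left i3 hy0
  have hq : (x ^ 2 - v ^ 2) * (1 - K ^ 2 * a ^ 2) + 2 * K * y ^ 2 * (v ^ 2 - v * x) ≤ max (x ^ 2 - v ^ 2) 0 := by
    rcases le_total v x with hc | hc
    · apply le_max_of_le_left
      have z1 : 0 ≤ x ^ 2 - v ^ 2 := by nlinarith only [hv, hc, hx]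
      have z2 : 0 ≤ (x ^ 2 - v ^ 2) * (K ^ 2 * a ^ 2) := mul_nonneg z1 (by positivity)
      have z3 : 0 ≤ 2 * K * y ^ 2 * (v * x - v ^ 2) := mul_nonneg (by positivity) (by nlinarith only [hv, hc])
      linarith only [z2, z3]
    · apply le_max_of_le_right
      have z1 : 0 ≤ v ^ 2 - x ^ 2 := by nlinarith only [hv, hc, hx]
      have z2 : 0 ≤ (v ^ 2 - x ^ 2) * (0.8 - K ^ 2 * a ^ 2) := mul_nonneg z1 (by linarith only [hKa])
      have z3 : v ^ 2 - v * x ≤ v ^ 2 - x ^ 2 := by nlinarith only [hx, hc]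
      have z5 : 0 ≤ v ^ 2 - v * x := by nlinarith only [hv, hc]
      have z4 : 2 * K * y ^ 2 ≤ 0.2 := by nlinarith only [hy, hK2]
      have z6 : 2 * K * y ^ 2 * (v ^ 2 - v * x) ≤ 0.2 * (v ^ 2 - x ^ 2) :=
        mul_le_mul z4 z3 z5 (by norm_num)
      linarith only [z2, z6]
  rw [id1]
  linarith only [sq_nonneg e, i2, i4, i5, hq]

lemma q_lower (K v x a e : ℝ) (hv : 0 < v) (hx : 0 < x)
    (hKa : K ^ 2 * a ^ 2 ≤ 0.8) (hQ : -0.25 ≤ x ^ 2 - v ^ 2)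
    (he1 : e ≤ 0) (he2 : 0 ≤ 2 * (v + K * x * a) + e) :
    -0.25 ≤ (x + K * v * a) ^ 2 - (v + K * x * a + e) ^ 2 := by
  have id1 : (x + K * v * a) ^ 2 - (v + K * x * a + e) ^ 2 =
      (x ^ 2 - v ^ 2) * (1 - K ^ 2 * a ^ 2) + (-e) * (2 * (v + K * x * a) + e) := by ring
  rw [id1]
  have i1 : 0 ≤ (-e) * (2 * (v + K * x * a) + e) := mul_nonneg (by linarith only [he1]) he2
  have i0 : 0 ≤ K ^ 2 * a ^ 2 := by positivity
  have i2 : -0.25 ≤ (x ^ 2 - v ^ 2) * (1 - K ^ 2 * a ^ 2) := by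
    rcases le_total 0 (x ^ 2 - v ^ 2) with hc | hc
    · have := mul_nonneg hc (by linarith only [hKa] : 0 ≤ 1 - K ^ 2 * a ^ 2)
      linarith only [this]
    · have := mul_nonneg (neg_nonneg.2 hc) i0
      linarith only [hQ, this]
  linarith only [i1, i2]

set_option maxHeartbeats 1000000 in
lemma phase2_core (K v x r h g c : ℝ) (hK1 : 1 ≤ K) (hK2 : K ≤ 1.1) (hv : 0 < v) (hx : 0 < x)
    (hP1 : 1.48 ≤ v + x) (hP2 : v + x ≤ 2.28) (hQ1 : -0.25 ≤ x ^ 2 - v ^ 2)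
    (hQ2 : x ^ 2 - v ^ 2 ≤ 0.47) (hr : 0 ≤ r) (hy : r * x ≤ 0.247) (h0 : 0 ≤ h)
    (h1 : h ≤ 0.1592) (g0 : 0 ≤ g) (g2 : g ≤ r ^ 2 * h)
    (hc1 : v * ((r * x) ^ 2 + r ^ 2 * h) ≤ c)
    (hc2 : 1.48 ≤ 2.1 * (v + x) - 0.275 * (v + x) ^ 3 - 1.1 * c) :
    1.48 ≤ (v + K * x * (1 - g - v * x) + K * x * r ^ 2 * (h - v * x)) + (x + K * v * (1 - g - v * x)) ∧
    (v + K * x * (1 - g - v * x) + K * x * r ^ 2 * (h - v * x)) + (x + K * v * (1 - g - v * x)) ≤ 2.28 ∧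
    -0.25 ≤ (x + K * v * (1 - g - v * x)) ^ 2 - (v + K * x * (1 - g - v * x) + K * x * r ^ 2 * (h - v * x)) ^ 2 ∧
    (x + K * v * (1 - g - v * x)) ^ 2 - (v + K * x * (1 - g - v * x) + K * x * r ^ 2 * (h - v * x)) ^ 2 ≤
      max (x ^ 2 - v ^ 2) 0 + 2.205 * (r * x) ^ 2 := by
  have hy0 : 0 ≤ r * x := mul_nonneg hr hx.le
  have hd1 : x - v ≤ 0.3176 := by
    clear hc1 hc2 g2 hy hy0
    by_contra hc
    have : 0.3176 * (v + x) ≤ (x - v) * (v + x) := mul_le_mul_of_nonneg_right (by linarith only [hc]) (by linarith only [hv, hP2, hc])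
    linarith only [hv, hP1, hQ2, hc, this]
  have hd2 : -0.17 ≤ x - v := by
    clear hc1 hc2 g2 hy hy0
    by_contra hc
    have : (x - v) * (v + x) ≤ -0.17 * (v + x) := mul_le_mul_of_nonneg_right (by linarith only [hc]) (by linarith only [hx, hc])
    linarith only [hx, hP1, hQ1, hc, this]
  have hw4 : v * x = (v + x) ^ 2 / 4 - (x - v) ^ 2 / 4 := by ring
  have hdsq : (x - v) ^ 2 ≤ 0.1009 := by
    have := sq_le_sq' (by linarith only [hx, hP2, hd2] : -0.3176 ≤ x - v) hd1
    linarith only [this]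
  have hwl : 0.52 ≤ v * x := by
    have := pow_le_pow_left₀ (by norm_num) hP1 2
    clear hc1 hc2 g2 hy hy0
    linarith only [hdsq, this]
  have hwu : v * x ≤ 1.3 := by
    have := pow_le_pow_left₀ (by linarith only [hv, hx]) hP2 2
    have := sq_nonneg (x - v)
    clear hc1 hc2 g2 hy hy0
    linarith
  have hx1 : 0.655 ≤ x := by linarith only [hP1, hd2]
  have hx2 : x ≤ 1.3 := by linarith only [hv, hP2, hd1]
  have hv1 : 0.58 ≤ v := by linarith only [hv, hP1, hd1]
  have hv2 : v ≤ 1.225 := by linarith only [hP2, hd2]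
  have hr1 : r ≤ 0.378 := by
    by_contra hc
    have : 0.378 * 0.655 ≤ r * x := mul_le_mul (by linarith only [hc]) hx1 (by norm_num) hr
    linarith only [hy, this]
  have hg1 : g ≤ 0.03 := by
    have : r ^ 2 ≤ 0.378 ^ 2 := pow_le_pow_left₀ hr hr1 2
    have : r ^ 2 * h ≤ 0.378 ^ 2 * 0.1592 := mul_le_mul this h1 h0 (by norm_num)
    linarith only [g2, this]
  set w := v * x with hw
  have hrr : 0 ≤ r ^ 2 := sq_nonneg r
  set a := 1 - g - w with ha
  have ha1 : a ≤ 0.48 := by rw [ha]; linarith only [g0, hwl]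
  have ha2 : -0.33 ≤ a := by rw [ha]; linarith only [hg1, hwu]
  have hKa1 : K * a ≤ 0.53 := by
    have t1 : K * a ≤ K * 0.48 := mul_le_mul_of_nonneg_left ha1 (by linarith only [hK1])
    linarith only [hK2, t1]
  have hKa2 : -0.364 ≤ K * a := by
    have t1 : K * (-0.33) ≤ K * a := mul_le_mul_of_nonneg_left ha2 (by linarith only [hK1])
    linarith only [hK2, t1]
  have hKa : K ^ 2 * a ^ 2 ≤ 0.8 := by
    have : K ^ 2 * a ^ 2 = (K * a) ^ 2 := by ring
    rw [this]
    have := sq_le_sq' (by linarith only [hKa2] : -0.6 ≤ K * a) (by linarith only [hKa1])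
    linarith only [this]
  set e := K * x * r ^ 2 * (h - w) with he
  have he0 : e ≤ 0 := by
    have : 0 ≤ K * x * r ^ 2 := by positivity
    rw [he]; apply mul_nonpos_of_nonneg_of_nonpos this; linarith only [h1, hwl]
  have he1 : -(K * (r * x) ^ 2 * v) ≤ e := by
    have : 0 ≤ K * x * r ^ 2 * h := by positivity
    have : e = K * x * r ^ 2 * h - K * (r * x) ^ 2 * v := by rw [he, hw]; ring
    linarith
  have hysq : (r * x) ^ 2 ≤ 0.0611 := by
    have := pow_le_pow_left₀ hy0 hy 2
    linarith only [this]
  have he2 : -0.083 ≤ e := by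
    have a1 : (r * x) ^ 2 * v ≤ 0.0611 * 1.225 := mul_le_mul hysq hv2 hv.le (by norm_num)
    have a2 : K * ((r * x) ^ 2 * v) ≤ 1.1 * (0.0611 * 1.225) := mul_le_mul hK2 a1 (by positivity) (by norm_num)
    linarith only [he1, a2]
  have hva : 0.1 ≤ v + K * x * a := by
    have : x * (-0.364) ≤ x * (K * a) := mul_le_mul_of_nonneg_left hKa2 hx.le
    have : K * x * a = x * (K * a) := by ring
    linarith
  refine ⟨?_, ?_, ?_, ?_⟩
  · -- lower bound on the sum
    set B := (v + x) * (1 - w) - v * ((r * x) ^ 2 + r ^ 2 * h) with hB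
    have hB1 : (v + x) + K * B ≤ (v + K * x * a + e) + (x + K * v * a) := by
      have t : (v + K * x * a + e) + (x + K * v * a) - ((v + x) + K * B) = K * (v + x) * (r ^ 2 * h - g) := by
        rw [hB, he, ha, hw]; ring
      have : 0 ≤ K * (v + x) * (r ^ 2 * h - g) := mul_nonneg (by positivity) (by linarith only [g2])
      linarith only [this]
    rcases le_total 0 B with hb | hb
    · have : 0 ≤ K * B := mul_nonneg (by linarith only [hK1]) hb
      linarith only [hP1, hB1, this]
    · have t1 : 1.1 * B ≤ K * B := mul_le_mul_of_nonpos_right hK2 hb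
      have t2 : (v + x) * (1 - (v + x) ^ 2 / 4) - c ≤ B := by
        have : (v + x) * (1 - (v + x) ^ 2 / 4) ≤ (v + x) * (1 - w) := by
          apply mul_le_mul_of_nonneg_left _ (by linarith only [hv, hx])
          linarith only [sq_nonneg (x - v)]
        linarith only [hc1, this]
      linarith only [hc2, hB1, t1, t2]
  · rcases le_total a 0 with hb | hb
    · have : K * (v + x) * a ≤ 0 := mul_nonpos_of_nonneg_of_nonpos (by positivity) hb
      linarith only [hP2, he0, this]
    · have t1 : (v + x) * (K * a) ≤ (v + x) * (1.1 * (1.0253 - (v + x) ^ 2 / 4)) := by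
        apply mul_le_mul_of_nonneg_left _ (by linarith only [hv, hx])
        have : K * a ≤ 1.1 * a := mul_le_mul_of_nonneg_right hK2 hb
        have : a ≤ 1.0253 - (v + x) ^ 2 / 4 := by rw [ha]; linarith only [g0, hdsq]
        linarith
      have t2 : 0 ≤ ((v + x) - 1.606) ^ 2 * ((v + x) + 3.212) := by positivity
      have t3 : v + K * x * a + e + (x + K * v * a) = (v + x) + (v + x) * (K * a) + e := by ring
      rw [t3]
      clear_value a e w
      linarith only [hv, hx, he0, t1, t2]
  · exact q_lower K v x a e hv hx hKa hQ1 he0 (by linarith only [he2, hva])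
  · exact q_upper K v x (r * x) a w e hK1 hK2 hv hx hw (by linarith only [g0]) hKa (by linarith only [hva]) (by linarith only [hysq]) he1

lemma y_mult (K p v x r h κ : ℝ) (hK1 : 1 ≤ K) (hK2 : K ≤ 1.1) (hr : 0 ≤ r) (hx : 0 < x)
    (hvp : v = p * x) (hm : p * h ≤ v ^ 2) (hm0 : 0 ≤ p * h)
    (u1 : 1 + p * h - v ^ 2 ≤ κ) (u2 : 1.1 * v ^ 2 - 1 ≤ κ) :
    |x * (r * (1 + K * p * (h - p * x ^ 2)))| ≤ κ * (r * x) := by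
  have e : x * (r * (1 + K * p * (h - p * x ^ 2))) = (1 + K * (p * h - v ^ 2)) * (r * x) := by
    rw [hvp]; ring
  have hy : 0 ≤ r * x := mul_nonneg hr hx.le
  rw [e, abs_mul, abs_of_nonneg hy]
  apply mul_le_mul_of_nonneg_right _ hy
  rw [abs_le]
  constructor
  · have : K * v ^ 2 ≤ 1.1 * v ^ 2 := mul_le_mul_of_nonneg_right hK2 (sq_nonneg v)
    have : 0 ≤ K * (p * h) := mul_nonneg (by linarith only [hK1]) hm0
    linarith
  · have : K * (p * h - v ^ 2) ≤ 1 * (p * h - v ^ 2) := mul_le_mul_of_nonpos_right hK1 (by linarith only [hm])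
    linarith only [u1, this]

/-- `p h ≤ c v` when `x` is bounded below. -/
lemma ph_bound (p v x r h Y X c : ℝ) (hp : 0 < p) (hv : v = p * x) (hr : 0 ≤ r) (hX0 : 0 < X)
    (hX : X ≤ x) (hy : r * x ≤ Y) (h0 : 0 ≤ h) (hu : h * (1 + r ^ 2) ≤ 0.31832 * r)
    (hc : 0.31832 * Y ≤ c * X ^ 2) : p * h ≤ c * v := by
  have hx : 0 < x := by linarith only [hX0, hX]
  have a1 : h ≤ 0.31832 * r := by
    have : 0 ≤ h * r ^ 2 := by positivity
    linarith only [hu, this]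
  have a2 : h * x ≤ 0.31832 * Y := by
    have : h * x ≤ 0.31832 * r * x := mul_le_mul_of_nonneg_right a1 hx.le
    linarith only [hy, this]
  have hY : 0 ≤ Y := (mul_nonneg hr hx.le).trans hy
  have hc0 : 0 ≤ c := by
    by_contra hcon
    have : c * X ^ 2 < 0 := mul_neg_of_neg_of_pos (by linarith only [hcon]) (by positivity)
    linarith only [hc, hY, this]
  have a3 : X ^ 2 ≤ x ^ 2 := pow_le_pow_left₀ hX0.le hX 2
  have a4 : c * X ^ 2 ≤ c * x ^ 2 := mul_le_mul_of_nonneg_left a3 hc0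
  have a5 : h * x ≤ (c * x) * x := by linarith only [hc, a2, a4]
  have a6 : h ≤ c * x := le_of_mul_le_mul_right a5 hx
  rw [hv]
  calc p * h ≤ p * (c * x) := mul_le_mul_of_nonneg_left a6 hp.le
    _ = c * (p * x) := by ring


/-- One step of the recursion. -/
def NStep (K v x y v' x' y' : ℝ) : Prop :=
  v' = v + K * x * (1 - v * x - neuronGamma x y)
      + K * (y ^ 2 / v) * (-(v ^ 2) + v * y / (π * (x ^ 2 + y ^ 2))) ∧
  x' = x + K * v * (1 - v * x - neuronGamma x y) ∧
  y' = |y + K * y * (-(v ^ 2) + v * y / (π * (x ^ 2 + y ^ 2)))|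

lemma pos_of (V X : ℝ) (h1 : 1.48 ≤ V + X) (h2 : -0.25 ≤ X ^ 2 - V ^ 2)
    (h3 : X ^ 2 - V ^ 2 ≤ 0.47) : 0 < V ∧ 0 < X := by
  constructor
  · by_contra hc
    have a1 : 0 ≤ (X - V - 1.48) * (V + X) := mul_nonneg (by linarith only [h1, hc]) (by linarith only [h1])
    linarith only [h1, h3, a1]
  · by_contra hc
    have a1 : 0 ≤ (V - X - 1.48) * (V + X) := mul_nonneg (by linarith only [h1, hc]) (by linarith only [h1])
    linarith only [h1, h2, a1]

/-- The final invariant region. -/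
def RegD (v x y : ℝ) : Prop :=
  1.48 ≤ v + x ∧ v + x ≤ 2.28 ∧ -0.25 ≤ x ^ 2 - v ^ 2 ∧ x ^ 2 - v ^ 2 + 4.45 * y ^ 2 ≤ 0.47 ∧
    0 ≤ y ∧ y ≤ 0.14

def RegC (v x y : ℝ) : Prop :=
  1.6 ≤ v + x ∧ v + x ≤ 2.25 ∧ -0.25 ≤ x ^ 2 - v ^ 2 ∧ x ^ 2 - v ^ 2 ≤ 0.246 ∧
    0 ≤ y ∧ y ≤ 0.247

set_option maxHeartbeats 1000000 in
lemma regD_step (K v x y v' x' y' : ℝ) (hK1 : 1 ≤ K) (hK2 : K ≤ 1.1)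
    (hs : NStep K v x y v' x' y') (hR : RegD v x y) : RegD v' x' y' ∧ y' ≤ 0.7 * y := by
  obtain ⟨hP1, hP2, hQ1, hQ2, hy0, hy1⟩ := hR
  have hQ3 : x ^ 2 - v ^ 2 ≤ 0.47 := by nlinarith only [sq_nonneg y, hQ2]
  obtain ⟨hv, hx⟩ := pos_of v x hP1 hQ1 hQ3
  obtain ⟨p, r, w, h, g, hp, hr, hvp, hyr, hw, hw0, h0, h1, hl, hu, g0, g1, g2, ex, ev, ey⟩ :=
    bridge K v x y v' x' y' hv hx hy0 hs.1 hs.2.1 hs.2.2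
  have hwv : w = v * x := by rw [hw, hvp]; ring
  have hd1 : x - v ≤ 0.3176 := by
    by_contra hc
    have : 0.3176 * (v + x) ≤ (x - v) * (v + x) := mul_le_mul_of_nonneg_right (by linarith only [hc]) (by linarith only [hP2, hv, hc])
    linarith only [hP1, hQ3, hv, hc, this]
  have hd2 : -0.17 ≤ x - v := by
    by_contra hc
    have : (x - v) * (v + x) ≤ -0.17 * (v + x) := mul_le_mul_of_nonneg_right (by linarith only [hc]) (by linarith only [hx, hc])
    linarith only [hP1, hQ1, hx, hc, this]
  have hv1 : 0.581 ≤ v := by linarith only [hP1, hv, hd1]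
  have hv2 : v ≤ 1.225 := by linarith only [hP2, hd2]
  have hx1 : 0.655 ≤ x := by linarith only [hP1, hd2]
  have ex' : x' = x + K * v * (1 - g - v * x) := by rw [ex, hwv, hvp]; ring
  have ev' : v' = v + K * x * (1 - g - v * x) + K * x * r ^ 2 * (h - v * x) := by
    rw [ev, hwv, hvp]; ring
  clear ex ev hs hl g1
  have hyx : r * x ≤ 0.14 := by linarith only [hy1, hyr]
  have hr1 : r ≤ 0.2138 := by
    by_contra hc
    have : 0.2138 * 0.655 ≤ r * x := mul_le_mul (by linarith only [hc]) hx1 (by norm_num) hr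
    linarith only [hy1, hyr, this]
  have hrs : r ^ 2 ≤ 0.0458 := by
    have := pow_le_pow_left₀ hr hr1 2
    linarith only [this]
  have hyy : (r * x) ^ 2 ≤ 0.0196 := by
    have := pow_le_pow_left₀ (mul_nonneg hr hx.le) hyx 2
    linarith only [this]
  have hc1 : v * ((r * x) ^ 2 + r ^ 2 * h) ≤ 0.034 := by
    have a1 : r ^ 2 * h ≤ 0.0458 * 0.1592 := mul_le_mul hrs h1 h0 (by norm_num)
    have a2 : v * ((r * x) ^ 2 + r ^ 2 * h) ≤ 1.225 * 0.0270 :=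
      mul_le_mul hv2 (by linarith only [hyy, a1]) (by positivity) (by norm_num)
    linarith only [a2]
  have hc2 : 1.48 ≤ 2.1 * (v + x) - 0.275 * (v + x) ^ 3 - 1.1 * 0.034 := by
    have a1 : 0 ≤ (v + x - 1.48) * (2.28 - (v + x)) * (v + x + 3.76) :=
      mul_nonneg (mul_nonneg (by linarith only [hP1]) (by linarith only [hP2])) (by linarith only [hv, hx])
    linarith only [hP2, a1]
  obtain ⟨c1, c2, c3, c4⟩ := phase2_core K v x r h g 0.034 hK1 hK2 hv hx hP1 hP2 hQ1 hQ3 hr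
    (by linarith only [hy1, hyr]) h0 h1 g0 g2 hc1 hc2
  rw [← ex', ← ev'] at c1 c2 c3 c4
  have hm : 1 + p * h - v ^ 2 ≤ 0.7 ∧ p * h ≤ 0.11 * v := by
    rcases le_total v 0.6 with hc | hc
    · have := ph_bound p v x r h 0.14 0.88 0.0576 hp hvp hr (by norm_num) (by linarith only [hP1, hc]) hyx h0 hu (by norm_num)
      have a1 : 0 ≤ (v - 0.581) * (v + 0.581) := mul_nonneg (by linarith only [hP1, hv, hd1]) (by linarith only [hv, hc])
      constructor <;> linarith only [hv, hc, this, a1]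
    · rcases le_total v 0.7 with hd | hd
      · have := ph_bound p v x r h 0.14 0.78 0.0733 hp hvp hr (by norm_num) (by linarith only [hP1, hd]) hyx h0 hu (by norm_num)
        have a1 : 0 ≤ (v - 0.6) * (v + 0.6) := mul_nonneg (by linarith only [hc]) (by linarith only [hv, hd])
        constructor <;> linarith only [hv, hd, this, a1]
      · have := ph_bound p v x r h 0.14 0.655 0.104 hp hvp hr (by norm_num) (by linarith only [hP1, hd2]) hyx h0 hu (by norm_num)
        have a1 : 0 ≤ (v - 0.7) * (v + 0.6) := mul_nonneg (by linarith only [hd]) (by linarith only [hv])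
        constructor <;> linarith only [hP2, hx, this, a1, hv]
  have hyf : y' ≤ 0.7 * y := by
    rw [ey, hw, hyr]
    have s1 := pow_le_pow_left₀ hv.le hv2 2
    have s2 : 0 ≤ (v - 0.58) * v := mul_nonneg (by linarith only [hP1, hv, hd1]) hv.le
    exact y_mult K p v x r h 0.7 hK1 hK2 hr hx hvp (by linarith only [hm.2, hv, hm, s2]) (mul_nonneg hp.le h0) hm.1 (by linarith only [s1])
  have hy'0 : 0 ≤ y' := by rw [ey]; exact abs_nonneg _
  refine ⟨⟨c1, c2, c3, ?_, hy'0, by linarith only [hy1, hyf]⟩, hyf⟩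
  have b1 : y' ^ 2 ≤ 0.49 * y ^ 2 := by
    have := pow_le_pow_left₀ hy'0 hyf 2
    linarith only [this]
  rw [← hyr] at c4 hyy
  rcases le_total (x ^ 2 - v ^ 2) 0 with hc | hc
  · rw [max_eq_right hc] at c4; linarith only [hyy, c4, b1]
  · rw [max_eq_left hc] at c4; linarith only [hQ2, hQ3, c4, b1]

set_option maxHeartbeats 1000000 in
lemma regC_step (K v x y v' x' y' : ℝ) (hK1 : 1 ≤ K) (hK2 : K ≤ 1.1)
    (hs : NStep K v x y v' x' y') (hR : RegC v x y) : RegD v' x' y' := by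
  obtain ⟨hP1, hP2, hQ1, hQ2, hy0, hy1⟩ := hR
  obtain ⟨hv, hx⟩ := pos_of v x (by linarith only [hP1]) hQ1 (by linarith only [hQ2])
  obtain ⟨p, r, w, h, g, hp, hr, hvp, hyr, hw, hw0, h0, h1, hl, hu, g0, g1, g2, ex, ev, ey⟩ :=
    bridge K v x y v' x' y' hv hx hy0 hs.1 hs.2.1 hs.2.2
  have hwv : w = v * x := by rw [hw, hvp]; ring
  have hd1 : x - v ≤ 0.1538 := by
    by_contra hc
    have : 0.1538 * (v + x) ≤ (x - v) * (v + x) := mul_le_mul_of_nonneg_right (by linarith only [hc]) (by linarith only [hv, hc])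
    linarith only [hP1, hQ2, hv, hc, this]
  have hd2 : -0.157 ≤ x - v := by
    by_contra hc
    have : (x - v) * (v + x) ≤ -0.157 * (v + x) := mul_le_mul_of_nonneg_right (by linarith only [hc]) (by linarith only [hx, hc])
    linarith only [hP1, hQ1, hx, hc, this]
  have hv1 : 0.7231 ≤ v := by linarith only [hP1, hd1]
  have hx1 : 0.72 ≤ x := by linarith only [hP1, hx, hd2]
  have hv2 : v ≤ 1.181 := by
    by_contra hc
    have : x ≤ 1.069 := by linarith only [hP2, hc]
    clear hs ex ev ey hl hu g1 g2 hvp hyr hw hwv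
    nlinarith only [hP2, hQ1, hc, hP1]
  have ex' : x' = x + K * v * (1 - g - v * x) := by rw [ex, hwv, hvp]; ring
  have ev' : v' = v + K * x * (1 - g - v * x) + K * x * r ^ 2 * (h - v * x) := by
    rw [ev, hwv, hvp]; ring
  clear ex ev hs hl g1
  have hyx : r * x ≤ 0.247 := by linarith only [hy1, hyr]
  have hr1 : r ≤ 0.3431 := by
    by_contra hc
    have : 0.3431 * 0.72 ≤ r * x := mul_le_mul (by linarith only [hc]) hx1 (by norm_num) hr
    linarith only [hy1, hyr, this]
  have hrs : r ^ 2 ≤ 0.1178 := by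
    have := pow_le_pow_left₀ hr hr1 2
    linarith only [this]
  have hyy : (r * x) ^ 2 ≤ 0.061009 := by
    have := pow_le_pow_left₀ (mul_nonneg hr hx.le) hyx 2
    linarith only [this]
  have hc1 : v * ((r * x) ^ 2 + r ^ 2 * h) ≤ 0.0944 := by
    have a1 : r ^ 2 * h ≤ 0.1178 * 0.1592 := mul_le_mul hrs h1 h0 (by norm_num)
    have a2 : v * ((r * x) ^ 2 + r ^ 2 * h) ≤ 1.181 * 0.0799 :=
      mul_le_mul hv2 (by linarith only [hyy, a1]) (by positivity) (by norm_num)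
    linarith only [a2]
  have hc2 : 1.48 ≤ 2.1 * (v + x) - 0.275 * (v + x) ^ 3 - 1.1 * 0.0944 := by
    have a1 : 0 ≤ (v + x - 1.6) * (2.25 - (v + x)) * (v + x + 3.85) :=
      mul_nonneg (mul_nonneg (by linarith only [hP1]) (by linarith only [hP2])) (by linarith only [hv, hx])
    linarith only [hP2, a1]
  obtain ⟨c1, c2, c3, c4⟩ := phase2_core K v x r h g 0.0944 hK1 hK2 hv hx (by linarith only [hP1, hv, hx]) (by linarith only [hP2]) hQ1
    (by linarith only [hQ2]) hr (by linarith only [hy1, hyr]) h0 h1 g0 g2 hc1 hc2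
  rw [← ex', ← ev'] at c1 c2 c3 c4
  have hm : 1 + p * h - v ^ 2 ≤ 0.5665 ∧ p * h ≤ 0.16 * v := by
    rcases le_total v 0.75 with hc | hc
    · have := ph_bound p v x r h 0.247 0.85 0.1089 hp hvp hr (by norm_num) (by linarith only [hP1, hc]) hyx h0 hu (by norm_num)
      have a1 : 0 ≤ (v - 0.7231) * (v + 0.7231) := mul_nonneg (by linarith only [hP1, hd1]) (by linarith only [hv, hc])
      constructor <;> linarith only [hv, hc, this, a1]
    · have := ph_bound p v x r h 0.247 0.72 0.1518 hp hvp hr (by norm_num) (by linarith only [hP1, hx, hd2]) hyx h0 hu (by norm_num)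
      have a1 : 0 ≤ (v - 0.75) * (v + 0.59) := mul_nonneg (by linarith only [hc]) (by linarith only [hv])
      constructor <;> linarith only [hv, this, a1]
  have hyf : y' ≤ 0.5665 * y := by
    rw [ey, hw, hyr]
    have s1 := pow_le_pow_left₀ hv.le hv2 2
    have s2 : 0 ≤ (v - 0.58) * v := mul_nonneg (by linarith only [hP1, hv, hd1]) hv.le
    exact y_mult K p v x r h 0.5665 hK1 hK2 hr hx hvp (by linarith only [hm.2, hm]) (mul_nonneg hp.le h0) hm.1 (by linarith only [s1])
  have hy'0 : 0 ≤ y' := by rw [ey]; exact abs_nonneg _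
  have hyf2 : y' ≤ 0.14 := by linarith only [hy1, hyf]
  refine ⟨c1, c2, c3, ?_, hy'0, hyf2⟩
  have b1 : y' ^ 2 ≤ 0.0196 := by
    have := pow_le_pow_left₀ hy'0 hyf2 2
    linarith only [this]
  rcases le_total (x ^ 2 - v ^ 2) 0 with hc | hc
  · rw [max_eq_right hc] at c4; linarith only [hyy, c4, b1]
  · rw [max_eq_left hc] at c4; linarith only [hQ2, hyy, c4, b1]

def RegE (v x y : ℝ) : Prop :=
  0.49 ≤ x ∧ x ≤ 0.95 ∧ 0.94 * x ≤ v ∧ v ≤ 1.15 * x ∧ v ≤ 1.01 ∧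
    -0.25 ≤ x ^ 2 - v ^ 2 ∧ x ^ 2 - v ^ 2 ≤ 0.085 ∧ 0 ≤ y ∧ y ≤ 0.27

set_option maxHeartbeats 2000000 in
lemma regE_step (K v x y v' x' y' : ℝ) (hK1 : 1 ≤ K) (hK2 : K ≤ 1.1)
    (hs : NStep K v x y v' x' y') (hR : RegE v x y) : RegC v' x' y' := by
  obtain ⟨hx1, hx2, hp1, hp2, hv2, hQ1, hQ2, hy0, hy1⟩ := hR
  have hx : 0 < x := by linarith only [hx1]
  have hv : 0 < v := by linarith only [hp1, hx]
  obtain ⟨p, r, w, h, g, hp, hr, hvp, hyr, hw, hw0, h0, h1, hl, hu, g0, g1, g2, ex, ev, ey⟩ :=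
    bridge K v x y v' x' y' hv hx hy0 hs.1 hs.2.1 hs.2.2
  have hwv : w = v * x := by rw [hw, hvp]; ring
  have hpl : 0.94 ≤ p := by rw [hvp] at hp1; exact le_of_mul_le_mul_right hp1 hx
  have hpu : p ≤ 1.15 := by rw [hvp] at hp2; exact le_of_mul_le_mul_right hp2 hx
  have ex' : x' = x + K * v * (1 - g - w) := by rw [ex, hvp]; ring
  have ev' : v' = v + K * x * (1 - g - w) + K * x * r ^ 2 * (h - w) := by
    rw [ev, hvp]; ring
  have hyx : r * x ≤ 0.27 := by linarith only [hy1, hyr]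
  have hyx0 : 0 ≤ r * x := mul_nonneg hr hx.le
  have hyy : (r * x) ^ 2 ≤ 0.0729 := by
    have := pow_le_pow_left₀ hyx0 hyx 2
    linarith only [this]
  have hr1 : r ≤ 0.5511 := by
    by_contra hc
    have : 0.5511 * 0.49 ≤ r * x := mul_le_mul (by linarith only [hc]) hx1 (by norm_num) hr
    linarith only [hy1, hyr, this]
  have hrs : r ^ 2 ≤ 0.3038 := by
    have := pow_le_pow_left₀ hr hr1 2
    linarith only [this]
  have hxs : 0.2401 ≤ x ^ 2 := by
    have := pow_le_pow_left₀ (by norm_num) hx1 2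
    linarith only [this]
  have hwp : 0.2401 * p ≤ w := by
    rw [hw]; have := mul_le_mul_of_nonneg_left hxs hp.le
    linarith only [this]
  have hwl : 0.2256 ≤ w := by linarith only [hw0, hpl, hwp]
  have hwu : w ≤ 0.9595 := by
    have : v * x ≤ 1.01 * 0.95 := mul_le_mul hv2 hx2 hx.le (by norm_num)
    linarith only [hwv, this]
  have hg1 : g ≤ 0.0484 := by
    have : r ^ 2 * h ≤ 0.3038 * 0.1592 := mul_le_mul hrs h1 h0 (by norm_num)
    linarith only [g2, this]
  have hh : h ≤ 0.1346 := by
    by_contra hc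
    have a1 : 0.1346 * (1 + r ^ 2) ≤ h * (1 + r ^ 2) := mul_le_mul_of_nonneg_right (by linarith only [hc]) (by positivity)
    have a2 : 0 ≤ (0.5511 - r) * (1 - r) := mul_nonneg (by linarith only [hr1]) (by linarith only [hx2, hx, hr1])
    have a3 : 0 ≤ (0.5511 - r) * (1 - 0.5511) := mul_nonneg (by linarith only [hx2, hx, hu, hr1, a1, a2]) (by norm_num)
    have a4 : 0 ≤ (0.5511 - r) ^ 2 := sq_nonneg _
    have a5 : h * (1 + r ^ 2) > 0.1346 * (1 + r ^ 2) := mul_lt_mul_of_pos_right (by linarith only [hx2, hx, hu, hr1, a1, a2]) (by positivity)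
    linarith only [hx2, hx, hu, hr1, a1, a2]
  -- y bound
  have hy' : y' ≤ 0.247 := by
    rw [ey]
    have b1 : p * (h - w) ≤ -0.0856 := by
      have : p * (h - w) ≤ p * (0.1346 - 0.2401 * p) := mul_le_mul_of_nonneg_left (by linarith only [hwp, hh]) hp.le
      have : 0 ≤ (p - 0.94) * (p + 0.3) := mul_nonneg (by linarith only [hpl]) (by linarith only [hp])
      linarith
    have b2 : K * (p * (h - w)) ≤ 1 * (p * (h - w)) := mul_le_mul_of_nonpos_right hK1 (by linarith only [b1])
    have e : x * (r * (1 + K * p * (h - w))) = (1 + K * (p * (h - w))) * (r * x) := by ring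
    rw [e, abs_mul, abs_of_nonneg hyx0]
    have b3 : -1.13 ≤ K * (p * (h - w)) := by
      have c1 : p * w ≤ 1.0201 := by
        have : p * w = v ^ 2 := by rw [hw, hvp]; ring
        rw [this]
        have := pow_le_pow_left₀ hv.le hv2 2
        linarith only [this]
      have c2 : K * (p * w) ≤ 1.1 * 1.0201 := mul_le_mul hK2 c1 (by positivity) (by norm_num)
      have c3 : 0 ≤ K * (p * h) := by positivity
      linarith only [hx2, hx, c2, c3]
    have b4 : |1 + K * (p * (h - w))| ≤ 0.9144 := abs_le.2 ⟨by linarith only [hx2, hx, b3], by linarith only [b1, b2]⟩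
    have := mul_le_mul b4 hyx hyx0 (by norm_num)
    linarith only [this]
  set a := 1 - g - w with ha
  have ha1 : a ≤ 0.7744 := by rw [ha]; linarith only [hw0, g0, hpl, hwp]
  have ha2 : -0.008 ≤ a := by rw [ha]; linarith only [hwu, hg1]
  have hKa1 : K * a ≤ 0.852 := by
    have : K * a ≤ K * 0.7744 := mul_le_mul_of_nonneg_left ha1 (by linarith only [hK1])
    linarith only [hK2, this]
  have hKa2 : -0.0088 ≤ K * a := by
    have : K * (-0.008) ≤ K * a := mul_le_mul_of_nonneg_left ha2 (by linarith only [hK1])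
    linarith only [hK2, this]
  have hKa : K ^ 2 * a ^ 2 ≤ 0.8 := by
    have : K ^ 2 * a ^ 2 = (K * a) ^ 2 := by ring
    rw [this]
    have := sq_le_sq' (by linarith only [hx2, hx, hKa2] : -0.852 ≤ K * a) hKa1
    linarith only [this]
  set e := K * x * r ^ 2 * (h - w) with he
  have he0 : e ≤ 0 := by
    have : 0 ≤ K * x * r ^ 2 := by positivity
    rw [he]; apply mul_nonpos_of_nonneg_of_nonpos this; linarith only [hw0, h1, hpl, hwp]
  have he1 : -(K * (r * x) ^ 2 * v) ≤ e := by
    have : 0 ≤ K * x * r ^ 2 * h := by positivity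
    have : e = K * x * r ^ 2 * h - K * (r * x) ^ 2 * v := by rw [he, hwv]; ring
    linarith
  have he2 : -0.0811 ≤ e := by
    have a1 : (r * x) ^ 2 * v ≤ 0.0729 * 1.01 := mul_le_mul hyy hv2 hv.le (by norm_num)
    have a2 : K * ((r * x) ^ 2 * v) ≤ 1.1 * (0.0729 * 1.01) := mul_le_mul hK2 a1 (by positivity) (by norm_num)
    linarith only [hx2, hx, he1, a2]
  have hva : 0.1 ≤ v + K * x * a := by
    have : x * (-0.0088) ≤ x * (K * a) := mul_le_mul_of_nonneg_left hKa2 hx.le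
    have : K * x * a = x * (K * a) := by ring
    linarith
  have q1 := q_lower K v x a e hv hx hKa hQ1 he0 (by linarith only [hx2, hx, he2, hva])
  have q2 := q_upper K v x (r * x) a w e hK1 hK2 hv hx hwv (by linarith only [g0]) hKa (by linarith only [hva]) (by linarith only [hyy]) he1
  rw [← ex', ← ev'] at q1 q2
  have q3 : x' ^ 2 - v' ^ 2 ≤ 0.246 := by
    have : max (x ^ 2 - v ^ 2) 0 ≤ 0.085 := max_le hQ2 (by norm_num)
    linarith only [hx2, hx, hyy, q2, this]
  refine ⟨?_, ?_, q1, q3, by rw [ey]; exact abs_nonneg _, hy'⟩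
  · set B := (v + x) * (1 - w) - v * ((r * x) ^ 2 + r ^ 2 * h) with hB
    have hB1 : (v + x) + K * B ≤ v' + x' := by
      have t : (v + K * x * a + e) + (x + K * v * a) - ((v + x) + K * B) = K * (v + x) * (r ^ 2 * h - g) := by
        rw [hB, he, ha, hwv]; ring
      have : 0 ≤ K * (v + x) * (r ^ 2 * h - g) := mul_nonneg (by positivity) (by linarith only [g2])
      rw [ex', ev']
      linarith only [t, this]
    have t2 : (v + x) * (1 - (v + x) ^ 2 / 4) - 0.0391 * (v + x) - 0.0274 ≤ B := by
      have s1 : (v + x) * (1 - (v + x) ^ 2 / 4) ≤ (v + x) * (1 - w) := by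
        apply mul_le_mul_of_nonneg_left _ (by linarith only [hx, hv])
        rw [hwv]
        linarith only [sq_nonneg (x - v)]
      have s2 : v * (r * x) ^ 2 ≤ v * 0.0729 := mul_le_mul_of_nonneg_left hyy hv.le
      have s3 : v * (r ^ 2 * h) ≤ 0.0274 := by
        have c1 : v * (r ^ 2 * h) = p * r * h * (r * x) := by rw [hvp]; ring
        rw [c1]
        have c2 : p * r ≤ 1.15 * 0.5511 := mul_le_mul hpu hr1 hr (by norm_num)
        have c3 : p * r * h ≤ 1.15 * 0.5511 * 0.1592 := mul_le_mul c2 h1 h0 (by norm_num)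
        have c4 := mul_le_mul c3 hyx hyx0 (by norm_num)
        linarith only [c4]
      linarith only [hp2, hx, s1, s2, s3]
    have t3 : 0 ≤ (v + x - 0.95) * (1.96 - (v + x)) * (v + x + 2.91) :=
      mul_nonneg (mul_nonneg (by linarith only [hx1, hp1, hv]) (by linarith only [hx2, hv2])) (by linarith only [hx, hv])
    rcases le_total 0 B with hb | hb
    · have t1 : 1 * B ≤ K * B := mul_le_mul_of_nonneg_right hK1 hb
      linarith only [hx1, hp1, hv, hB1, t2, t3, t1]
    · have t1 : 1.1 * B ≤ K * B := mul_le_mul_of_nonpos_right hK2 hb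
      linarith only [hB1, t2, t3, hb, t1]
  · have t3 : v' + x' = (v + x) + (v + x) * (K * a) + e := by rw [ex', ev']; ring
    rw [t3]
    rcases le_total a 0 with hb | hb
    · have : (v + x) * (K * a) ≤ 0 := by
        have : K * a ≤ 0 := mul_nonpos_of_nonneg_of_nonpos (by linarith only [hK1]) hb
        exact mul_nonpos_of_nonneg_of_nonpos (by linarith only [hx, hv]) this
      linarith only [hx2, hp2, he0, this]
    · have hdsq : (x - v) ^ 2 ≤ 0.0204 := by
        have := sq_le_sq' (by linarith only [hx2, hp2] : -0.1425 ≤ x - v) (by linarith only [hx2, hp1, hv] : x - v ≤ 0.1425)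
        linarith only [this]
      have t1 : (v + x) * (K * a) ≤ (v + x) * (1.1 * (1.0051 - (v + x) ^ 2 / 4)) := by
        apply mul_le_mul_of_nonneg_left _ (by linarith only [hx, hv])
        have : K * a ≤ 1.1 * a := mul_le_mul_of_nonneg_right hK2 hb
        have : a ≤ 1.0051 - (v + x) ^ 2 / 4 := by rw [ha, hwv]; linarith only [g0, hdsq]
        linarith
      have t2 : 0 ≤ ((v + x) - 1.6) ^ 2 * ((v + x) + 3.2) := by positivity
      clear_value a e
      linarith only [hx1, hx, hv, he0, t1, t2]

def RegA (ε v x y : ℝ) : Prop :=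
  0.5 * ε ≤ x ∧ 1.3 * ε ≤ v ∧ 0.95 * x ≤ v ∧ v ≤ 2.65 * x ∧ 0 ≤ y ∧ y ≤ 2.65 * x ∧
    0.98 * y ≤ v ∧ y ≤ 1.351 * ε ∧ v ≤ 0.21 ∧ x ≤ 0.21 ∧ v + 1.1 * x + 0.36 * y ≤ 0.46

def RegB (ε v x y : ℝ) : Prop :=
  1.384 * ε ≤ x ∧ 1.716 * ε ≤ v ∧ 0.93 * x ≤ v ∧ v ≤ 1.47 * x ∧ 0 ≤ y ∧ y ≤ 1.21 * x ∧
    y ≤ 1.98 * ε ∧ v ≤ 0.46 ∧ x ≤ 0.45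

def RegF (v x y : ℝ) : Prop :=
  0 < x ∧ x ≤ 0.852 ∧ 0.94 * x ≤ v ∧ v ≤ 1.15 * x ∧ 0 ≤ y ∧ y ≤ 0.8 * x ∧ y ≤ 0.25

lemma gamma_init (x y : ℝ) (hx : 0 ≤ x) (hy : 0 ≤ y) :
    0 ≤ neuronGamma x y ∧ neuronGamma x y ≤ 0.5 := by
  rcases hx.lt_or_eq with h | h
  · obtain ⟨a, b, _⟩ := gamma_bounds x y h hy
    have : 0 ≤ x * y / (π * (x ^ 2 + y ^ 2)) := by
      have := Real.pi_pos
      positivity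
    exact ⟨a, by linarith only [b, this]⟩
  · have hpi := Real.pi_pos
    have : neuronGamma x y = 0.5 := by
      unfold neuronGamma
      rw [← h]
      simp
      field_simp
      norm_num
    rw [this]; norm_num

set_option maxHeartbeats 1000000 in
/-- The scale-free inequalities of the first step. -/
lemma step0_aux (K c s a q E : ℝ) (hK1 : 1 ≤ K) (hK2 : K ≤ 1.1) (hc : 0 ≤ c) (hs : 0 ≤ s)
    (hcs : c ^ 2 + s ^ 2 = 1) (ha1 : 0.5 - 0.01 * c ≤ a) (ha2 : a ≤ 1) (hq1 : 0.3183 ≤ q)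
    (hq2 : q ≤ 0.31832) (hE0 : 0 ≤ E) (hE : E ≤ 0.01) :
    0 ≤ s * (1 + K * (s * q - E)) ∧
    0.5 ≤ c + K * a ∧ 1.3 ≤ 1 + K * c * a + K * s ^ 2 * (s * q - E) ∧
    0.95 * (c + K * a) ≤ 1 + K * c * a + K * s ^ 2 * (s * q - E) ∧
    1 + K * c * a + K * s ^ 2 * (s * q - E) ≤ 2.65 * (c + K * a) ∧
    s * (1 + K * (s * q - E)) ≤ 2.65 * (c + K * a) ∧
    0.98 * (s * (1 + K * (s * q - E))) ≤ 1 + K * c * a + K * s ^ 2 * (s * q - E) ∧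
    s * (1 + K * (s * q - E)) ≤ 1.351 ∧
    1 + K * c * a + K * s ^ 2 * (s * q - E) ≤ 2.1 ∧
    c + K * a ≤ 2.1 ∧
    (1 + K * c * a + K * s ^ 2 * (s * q - E)) + 1.1 * (c + K * a) + 0.36 * (s * (1 + K * (s * q - E))) ≤ 4.6 := by
  have hc1 : c ≤ 1 := by nlinarith only [hcs, hc]
  have hs1 : s ≤ 1 := by nlinarith only [hcs, hs]
  have hs2 : s ^ 2 ≤ s := by nlinarith only [hs, hs1]
  have hs3 : s ^ 3 ≤ s ^ 2 := by nlinarith only [sq_nonneg s, hs1]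
  have hs0 : 0 ≤ s ^ 2 := sq_nonneg s
  have hs30 : 0 ≤ s ^ 3 := by positivity
  have ha0 : 0 ≤ a := by linarith only [ha1, hc1]
  have hz1 : K * a ≤ 1.1 := by nlinarith only [hK2, ha2, hK1]
  have hz2 : a ≤ K * a := by nlinarith only [hK1, ha1, hc1]
  have hz3 : K * (0.5 - 0.01 * c) ≤ K * a := mul_le_mul_of_nonneg_left ha1 (by linarith only [hK1])
  have hk1 : 0.3183 ≤ K * q := by nlinarith only [hK1, hq1]
  have hk2 : K * q ≤ 0.3502 := by nlinarith only [hK2, hq2, hK1]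
  have hk3 : K * q ≤ K * 0.31832 := mul_le_mul_of_nonneg_left hq2 (by linarith only [hK1])
  have hE2 : 0 ≤ K * E := mul_nonneg (by linarith only [hK1]) hE0
  have hE3 : K * E ≤ 0.011 := by nlinarith only [hK2, hE, hK1]
  have hK5 : 1 - 1.5 * c ^ 2 ≤ s ^ 3 := by nlinarith [mul_nonneg (sq_nonneg (s - 1)) (by linarith only [hs] : 0 ≤ 2 * s + 1)]
  have ev : 1 + K * c * a + K * s ^ 2 * (s * q - E) = 1 + c * (K * a) + s ^ 3 * (K * q) - s ^ 2 * (K * E) := by ring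
  have ey : s * (1 + K * (s * q - E)) = s + s ^ 2 * (K * q) - s * (K * E) := by ring
  rw [ev, ey]
  generalize K * a = z at *
  generalize K * E = F at *
  generalize hkq : K * q = k at *
  have m1 : 0 ≤ s ^ 2 * F := mul_nonneg hs0 hE2
  have m2 : 0 ≤ s * F := mul_nonneg hs hE2
  have m3 : s ^ 2 * F ≤ s ^ 2 * 0.011 := mul_le_mul_of_nonneg_left hE3 hs0
  have m4 : s * F ≤ s * 0.011 := mul_le_mul_of_nonneg_left hE3 hs
  have m5 : s ^ 3 * 0.3183 ≤ s ^ 3 * k := mul_le_mul_of_nonneg_left hk1 hs30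
  have m6 : s ^ 2 * 0.3183 ≤ s ^ 2 * k := mul_le_mul_of_nonneg_left hk1 hs0
  have m7 : s ^ 3 * k ≤ s ^ 3 * 0.3502 := mul_le_mul_of_nonneg_left hk2 hs30
  have m8 : s ^ 2 * k ≤ s ^ 2 * 0.3502 := mul_le_mul_of_nonneg_left hk2 hs0
  have m9 : c * (0.5 - 0.01 * c) ≤ c * z := mul_le_mul_of_nonneg_left (by linarith only [ha1, hz2]) hc
  have m10 : c * z ≤ c * 1.1 := mul_le_mul_of_nonneg_left hz1 hc
  have m11 : 0 ≤ c * (1 - c) := mul_nonneg hc (by linarith only [hc1])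
  have m12 : K * (0.5 - 0.01 * c) * (2.65 - c) ≤ z * (2.65 - c) := mul_le_mul_of_nonneg_right hz3 (by linarith only [hc1])
  have m13 : s ^ 3 * k ≤ 1 * k := mul_le_mul_of_nonneg_right (by linarith only [hs1, hs2, hs3]) (by linarith only [hk1])
  have m14 : s ^ 2 * k ≤ 1 * k := mul_le_mul_of_nonneg_right (by linarith only [hs1, hs2]) (by linarith only [hk1])
  have m15 : 0 ≤ (K - 1) * (1 - 0.5265 * c) := mul_nonneg (by linarith only [hK1]) (by linarith only [hc1])
  have m16 : 0 ≤ K * c ^ 2 := by positivity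
  refine ⟨by linarith only [hs, hcs, hc1, m4, m6, m11], by linarith only [hc, ha1, hz2], by linarith only [hc, hcs, hK5, m3, m5, m9, m11], ?_, ?_, ?_, ?_, by linarith only [hs1, hs2, m2, m8], by linarith only [sq_nonneg (1 - c), hcs, hc1, hs3, m1, m7, m10], by linarith only [hc1, hz1], ?_⟩
  · rcases le_total 0.95 c with hd | hd
    · have n1 : 0 ≤ z * (c - 0.95) := mul_nonneg (by linarith only [ha1, hc1, hz2]) (by linarith only [hd])
      have n2 : 0 ≤ c * (c - 0.95) := mul_nonneg hc (by linarith only [hd])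
      linarith only [hc1, hs1, hs2, hs30, m3, m5, n1]
    · have n1 : z * (0.95 - c) ≤ 1.1 * (0.95 - c) := mul_le_mul_of_nonneg_right hz1 (by linarith only [hd])
      rcases le_total c 0.3 with hf | hf
      · have n3 : 0 ≤ c * (0.3 - c) := mul_nonneg hc (by linarith only [hf])
        linarith only [hcs, hs30, hK5, m3, m5, m11, n1]
      · have n4 : 0.3 ≤ s := by
          by_contra hcon
          have o1 : s ^ 2 ≤ 0.3 ^ 2 := pow_le_pow_left₀ hs (by linarith only [hcon]) 2
          have o2 : c ^ 2 ≤ 0.95 ^ 2 := pow_le_pow_left₀ hc hd 2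
          norm_num at o1 o2
          linarith only [hcs, o1, o2]
        have n5 : 0 ≤ s ^ 2 * (s - 0.3) := mul_nonneg hs0 (by linarith only [n4])
        linarith only [hcs, hs30, hK5, m3, m5, m11, n1]
  · linarith only [hc, ha1, hz2, hz3, hk3, m1, m10, m13, m15]
  · have n1 : K * (0.5 - 0.01 * c) * 2.65 ≤ z * 2.65 := mul_le_mul_of_nonneg_right hz3 (by norm_num)
    have n2 : 0 ≤ (K - 1) * (1 - c) := mul_nonneg (by linarith only [hK1]) (by linarith only [hc1])
    linarith only [hc, ha1, hs1, hz2, hz3, hk3, m2, m14, m15]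
  · have n0 : 0 ≤ c * z := mul_nonneg hc (by linarith only [ha1, hc1, hz2])
    rcases le_total 0.98 s with hd | hd
    · have n1 : 0 ≤ s ^ 2 * k * (s - 0.98) := mul_nonneg (mul_nonneg hs0 (by linarith only [hk1])) (by linarith only [hd])
      have n2 : s * F * (s - 0.98) ≤ 0.011 * 0.02 := mul_le_mul (by linarith only [hs1, m4]) (by linarith only [hs1]) (by linarith only [hd]) (by norm_num)
      linarith only [hK2, hc, hcs, hs1, hK5, hk3, m2, m3, m5, m9, m14, n1]
    · have n1 : s ^ 2 * k * (0.98 - s) ≤ 0.3502 * (0.98 - s) := mul_le_mul_of_nonneg_right (by linarith only [hs2, m8, hd]) (by linarith only [hd])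
      have n2 : 0 ≤ s * F * (0.98 - s) := mul_nonneg m2 (by linarith only [hd])
      linarith only [hcs, hs2, hK5, m2, m3, m5, m8, m9, m11, hd]
  · have n1 : 2.2 * c + 0.8363 * s ≤ 2.36 := by
      apply abs_le_of_sq_le_sq' _ (by norm_num) |>.2
      linarith only [sq_nonneg (0.8363 * c - 2.2 * s), hcs]
    linarith only [hc1, hs2, hs3, hz1, m1, m2, m7, m8, m10, n1]

lemma step0 (K ε x y v' x' y' : ℝ) (hK1 : 1 ≤ K) (hK2 : K ≤ 1.1) (hε : 0 < ε) (hε2 : ε ≤ 0.1)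
    (hx : 0 ≤ x) (hy : 0 ≤ y) (hn : x ^ 2 + y ^ 2 = ε ^ 2)
    (hs : NStep K ε x y v' x' y') : RegA ε v' x' y' := by
  obtain ⟨g0, g1⟩ := gamma_init x y hx hy
  obtain ⟨i1, i2⟩ := inv_pi_bounds
  obtain ⟨e1, e2, e3⟩ := hs
  have hpi := Real.pi_pos
  have hc : 0 ≤ x / ε := by positivity
  have hs : 0 ≤ y / ε := by positivity
  have hE : ε ^ 2 ≤ 0.01 := by nlinarith only [hε2, hε]
  have hcs : (x / ε) ^ 2 + (y / ε) ^ 2 = 1 := by field_simp; linarith only [hn]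
  have hex : ε * x = ε ^ 2 * (x / ε) := by field_simp
  have hex2 : ε ^ 2 * (x / ε) ≤ 0.01 * (x / ε) := mul_le_mul_of_nonneg_right hE hc
  have hex3 : 0 ≤ ε ^ 2 * (x / ε) := by positivity
  obtain ⟨f0, f1, f2, f3, f4, f5, f6, f7, f8, f9, f10⟩ := step0_aux K (x / ε) (y / ε)
    (1 - ε * x - neuronGamma x y) (1 / π) (ε ^ 2) hK1 hK2 hc hs hcs (by rw [hex]; linarith only [g1, hex2])
    (by rw [hex]; linarith only [g0, hex3]) i1 i2 (by positivity) hE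
  rw [hn] at e1 e3
  have ev : v' = ε * (1 + K * (x / ε) * (1 - ε * x - neuronGamma x y) +
      K * (y / ε) ^ 2 * (y / ε * (1 / π) - ε ^ 2)) := by
    rw [e1]; field_simp; ring
  have ex : x' = ε * (x / ε + K * (1 - ε * x - neuronGamma x y)) := by
    rw [e2]; field_simp
  have ey : y' = ε * (y / ε * (1 + K * (y / ε * (1 / π) - ε ^ 2))) := by
    rw [← abs_of_nonneg (mul_nonneg hε.le f0), e3]; congr 1; field_simp; ring
  generalize 1 + K * (x / ε) * (1 - ε * x - neuronGamma x y) +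
      K * (y / ε) ^ 2 * (y / ε * (1 / π) - ε ^ 2) = V at *
  generalize x / ε + K * (1 - ε * x - neuronGamma x y) = X at *
  generalize y / ε * (1 + K * (y / ε * (1 / π) - ε ^ 2)) = Y at *
  clear e1 e2 e3 hex hex2 hex3 hcs hn
  subst ev ex ey
  have M : ∀ A B : ℝ, A ≤ B → ε * A ≤ ε * B := fun A B h => mul_le_mul_of_nonneg_left h hε.le
  refine ⟨by linarith only [M _ _ f1, M, f1], by linarith only [M _ _ f2, M, f2], by linarith only [M _ _ f3, M, f3], by linarith only [M _ _ f4, M, f4],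
    mul_nonneg hε.le f0, by linarith only [M _ _ f5, M, f5], by linarith only [M _ _ f6, M, f6], by linarith only [M _ _ f7, M, f7],
    by linarith only [M _ _ f8, hε2, M, f8], by linarith only [M _ _ f9, hε2, M, f9], by linarith only [M _ _ f10, hε2, M, f10]⟩

set_option maxHeartbeats 1000000 in
lemma regA_step (K ε v x y v' x' y' : ℝ) (hK1 : 1 ≤ K) (hK2 : K ≤ 1.1) (hε : 0 < ε)
    (hs : NStep K v x y v' x' y') (hR : RegA ε v x y) : RegB ε v' x' y' := by
  obtain ⟨r1, r2, r3, r4, hy0, r5, r6, r7, r8, r9, r10⟩ := hR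
  have hx : 0 < x := by linarith only [hε, r1]
  have hv : 0 < v := by linarith only [hε, r2]
  obtain ⟨p, r, w, h, g, hp, hr, hvp, hyr, hw, hw0, h0, h1, hl, hu, g0, g1, g2, ex, ev, ey⟩ :=
    bridge K v x y v' x' y' hv hx hy0 hs.1 hs.2.1 hs.2.2
  clear hs
  have hp1 : 0.95 ≤ p := by rw [hvp] at r3; exact le_of_mul_le_mul_right r3 hx
  have hp2 : p ≤ 2.65 := by rw [hvp] at r4; exact le_of_mul_le_mul_right r4 hx
  have hr2 : r ≤ 2.65 := by rw [hyr] at r5; exact le_of_mul_le_mul_right r5 hx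
  have hrp : 0.98 * r ≤ p := by
    rw [hyr, hvp, ← mul_assoc] at r6; exact le_of_mul_le_mul_right r6 hx
  have hpw : p * w = v ^ 2 := by rw [hw, hvp]; ring
  have hv2 : v ^ 2 ≤ 0.21 ^ 2 := pow_le_pow_left₀ hv.le r8 2
  norm_num at hv2
  obtain ⟨s1, s2, s3, s4, s5⟩ := step1 K p r w h g hK1 hK2 hp1 hp2 hr hr2 hrp hw0
    (by rw [mul_comm, hpw]; linarith only [hv2]) h0 h1 hl hu g0 g1 g2
  have hKp : K * p ≤ 1.1 * 2.65 := mul_le_mul hK2 hp2 hp.le (by norm_num)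
  have hKp0 : 0 ≤ K * p := by positivity
  have n1 : 0 ≤ 1 + K * p * (h - w) := by
    have a1 : 0 ≤ K * p * h := mul_nonneg hKp0 h0
    have a2 : K * (p * w) ≤ 1.1 * 0.0441 := mul_le_mul hK2 (by rw [hpw]; linarith only [hv2]) (by positivity) (by norm_num)
    linarith only [hε, r2, r8, a1, a2]
  have n2 : 1 + K * p * (h - w) ≤ 1.4641 := by
    have a1 : K * p * h ≤ 1.1 * 2.65 * 0.1592 := mul_le_mul hKp h1 h0 (by norm_num)
    have a2 : 0 ≤ K * p * w := by positivity
    linarith only [hε, r2, r8, a1, a2]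
  have M : ∀ A B : ℝ, A ≤ B → x * A ≤ x * B := fun A B h => mul_le_mul_of_nonneg_left h hx.le
  have ey2 : y' = x * (r * (1 + K * p * (h - w))) := by
    rw [ey, abs_of_nonneg (mul_nonneg hx.le (mul_nonneg hr n1))]
  have ey3 : y' = y * (1 + K * p * (h - w)) := by rw [ey2, hyr]; ring
  have ex2 : x' = x + K * v * (1 - g - w) := by rw [ex, hvp]; ring
  have ev2 : v' = v + K * x * (1 - g - w) + K * r ^ 2 * (h - w) * x := by rw [ev, hvp]; ring
  have ha : 1 - g - w ≤ 1 := by linarith only [hw0, g0]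
  refine ⟨?_, ?_, ?_, ?_, by rw [ey]; exact abs_nonneg _, ?_, ?_, ?_, ?_⟩
  · rw [ex2]
    have a1 : v ≤ K * v := le_mul_of_one_le_left hv.le hK1
    have a2 : 1.3 * ε * 0.68 ≤ K * v * (1 - g - w) := mul_le_mul (by linarith only [r2, a1]) s1 (by norm_num) (by positivity)
    linarith only [r1, a2]
  · rw [ev]
    have := M _ _ s5
    have : x * (1.32 * p) = 1.32 * v := by rw [hvp]; ring
    linarith
  · rw [ex, ev]; linarith only [M _ _ s3, M, s3]
  · rw [ex, ev]; linarith only [M _ _ s4, M, s4]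
  · rw [ex, ey2]; linarith only [M _ _ s2, M, s2]
  · rw [ey3]
    have := mul_le_mul r7 n2 n1 (by positivity)
    linarith only [hε, this]
  · rw [ev2]
    have a1 : K * x * (1 - g - w) ≤ 1.1 * x * 1 := by
      apply mul_le_mul _ ha (by linarith only [hε, r2, r8, s1]) (by positivity)
      exact mul_le_mul_of_nonneg_right hK2 hx.le
    have a2 : r * h ≤ 0.31832 := by
      by_contra hc
      have b1 : 0.31832 * (1 + r ^ 2) ≤ r * h * (1 + r ^ 2) := mul_le_mul_of_nonneg_right (by linarith only [hc]) (by positivity)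
      have b2 : r * (h * (1 + r ^ 2)) ≤ r * (0.31832 * r) := mul_le_mul_of_nonneg_left hu hr
      linarith only [hε, r2, r8, b1, b2]
    have a3 : K * r ^ 2 * (h - w) * x ≤ 0.36 * y := by
      have b0 : K * r ^ 2 * (h - w) * x = K * (r * h) * y - K * r ^ 2 * w * x := by rw [hyr]; ring
      have b1 : 0 ≤ K * r ^ 2 * w * x := by positivity
      have b2 : K * (r * h) ≤ 1.1 * 0.31832 := mul_le_mul hK2 a2 (mul_nonneg hr h0) (by norm_num)
      have b3 : K * (r * h) * y ≤ 0.36 * y := mul_le_mul_of_nonneg_right (by linarith only [hε, r2, r8, b2]) hy0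
      linarith only [b0, b1, b3]
    linarith only [r10, a1, a3]
  · rw [ex2]
    have a1 : K * v * (1 - g - w) ≤ 1.1 * 0.21 * 1 := by
      apply mul_le_mul _ ha (by linarith only [hε, r2, r8, s1]) (by positivity)
      exact mul_le_mul hK2 r8 hv.le (by norm_num)
    linarith only [r3, r8, r9, a1]

set_option maxHeartbeats 1000000 in
lemma regB_step (K ε v x y v' x' y' : ℝ) (hK1 : 1 ≤ K) (hK2 : K ≤ 1.1) (hε : 0 < ε) (hε2 : ε ≤ 0.1)
    (hs : NStep K v x y v' x' y') (hR : RegB ε v x y) : RegF v' x' y' ∧ 2.4 * ε ≤ x' := by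
  obtain ⟨r1, r2, r3, r4, hy0, r5, r7, r8, r9⟩ := hR
  have hx : 0 < x := by linarith only [hε, r1]
  have hv : 0 < v := by linarith only [hε, r2]
  obtain ⟨p, r, w, h, g, hp, hr, hvp, hyr, hw, hw0, h0, h1, hl, hu, g0, g1, g2, ex, ev, ey⟩ :=
    bridge K v x y v' x' y' hv hx hy0 hs.1 hs.2.1 hs.2.2
  clear hs
  have hp1 : 0.93 ≤ p := by rw [hvp] at r3; exact le_of_mul_le_mul_right r3 hx
  have hp2 : p ≤ 1.47 := by rw [hvp] at r4; exact le_of_mul_le_mul_right r4 hx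
  have hr2 : r ≤ 1.21 := by rw [hyr] at r5; exact le_of_mul_le_mul_right r5 hx
  have hwv : w = v * x := by rw [hw, hvp]; ring
  have hw1 : w ≤ 0.46 * 0.45 := by rw [hwv]; exact mul_le_mul r8 r9 hx.le (by norm_num)
  have hw2 : w ≤ 0.2025 * p := by
    have : x ^ 2 ≤ 0.45 ^ 2 := pow_le_pow_left₀ hx.le r9 2
    have : p * x ^ 2 ≤ p * 0.45 ^ 2 := mul_le_mul_of_nonneg_left this hp.le
    linarith only [hw, this]
  obtain ⟨s1, s2, s3, s4⟩ := step2 K p r w h g hK1 hK2 hp1 hp2 hr hr2 hw0 (by linarith only [hw1]) hw2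
    h0 h1 hl g0 g1 g2
  have hKp : K * p ≤ 1.1 * 1.47 := mul_le_mul hK2 hp2 hp.le (by norm_num)
  have hKp0 : 0 ≤ K * p := by positivity
  have n1 : 0 ≤ 1 + K * p * (h - w) := by
    have a1 : 0 ≤ K * p * h := mul_nonneg hKp0 h0
    have a2 : K * p * w ≤ 1.1 * 1.47 * (0.46 * 0.45) := mul_le_mul hKp hw1 hw0.le (by norm_num)
    linarith only [hε, hε2, a1, a2]
  have n2 : 1 + K * p * (h - w) ≤ 1.2575 := by
    have a1 : K * p * h ≤ 1.1 * 1.47 * 0.1592 := mul_le_mul hKp h1 h0 (by norm_num)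
    have a2 : 0 ≤ K * p * w := by positivity
    linarith only [hε, hε2, a1, a2]
  have M : ∀ A B : ℝ, A ≤ B → x * A ≤ x * B := fun A B h => mul_le_mul_of_nonneg_left h hx.le
  have ey2 : y' = x * (r * (1 + K * p * (h - w))) := by
    rw [ey, abs_of_nonneg (mul_nonneg hx.le (mul_nonneg hr n1))]
  have ey3 : y' = y * (1 + K * p * (h - w)) := by rw [ey2, hyr]; ring
  have ex2 : x' = x + K * v * (1 - g - w) := by rw [ex, hvp]; ring
  have ha : 1 - g - w ≤ 1 - v * x := by linarith only [g0, hwv]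
  have hx' : 2.4 * ε ≤ x' := by
    rw [ex2]
    have a1 : v ≤ K * v := le_mul_of_one_le_left hv.le hK1
    have a2 : 1.716 * ε * 0.6 ≤ K * v * (1 - g - w) := mul_le_mul (by linarith only [r2, a1]) s1 (by norm_num) (by positivity)
    linarith only [hε, r1, a2]
  refine ⟨⟨by linarith only [hε, hx'], ?_, ?_, ?_, by rw [ey]; exact abs_nonneg _, ?_, ?_⟩, hx'⟩
  · rw [ex2]
    have a1 : K * v * (1 - g - w) ≤ 1.1 * v * (1 - v * x) := by
      apply mul_le_mul _ ha (by linarith only [hε, hε2, h0, g1, hw1]) (by positivity)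
      exact mul_le_mul_of_nonneg_right hK2 hv.le
    have a3 : 0 ≤ (0.45 - x) * (1 - 1.1 * v ^ 2) := by
      apply mul_nonneg (by linarith only [r9])
      have : v ^ 2 ≤ 0.46 ^ 2 := pow_le_pow_left₀ hv.le r8 2
      norm_num at this ⊢
      linarith only [hε, hε2, this]
    have a4 : 0 ≤ (0.46 - v) * (1 - 0.45 * (v + 0.46)) := mul_nonneg (by linarith only [r8]) (by linarith only [hε, hε2, r8])
    linarith only [hε, hε2, a1, a3, a4]
  · rw [ex, ev]; linarith only [M _ _ s3, M, s3]
  · rw [ex, ev]; linarith only [M _ _ s4, M, s4]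
  · rw [ex, ey2]; linarith only [M _ _ s2, M, s2]
  · rw [ey3]
    have := mul_le_mul r7 n2 n1 (by positivity)
    linarith only [hε, hε2, this]

lemma regF_big (v x y : ℝ) (hR : RegF v x y) (hx : 0.49 ≤ x) : RegE v x y := by
  obtain ⟨h0, h1, h2, h3, h4, h5, h6⟩ := hR
  have a0 : x ^ 2 ≤ 0.852 ^ 2 := pow_le_pow_left₀ h0.le h1 2
  have a1 : (0.94 * x) ^ 2 ≤ v ^ 2 := pow_le_pow_left₀ (by linarith only [h0]) h2 2
  have a2 : v ^ 2 ≤ (1.15 * x) ^ 2 := pow_le_pow_left₀ (by linarith only [h0, h2]) h3 2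
  norm_num at a0
  exact ⟨hx, by linarith only [h0, h1], h2, h3, by linarith only [h0, h1, h3], by linarith only [h0, h1, a2, a0], by linarith only [h0, h1, a1, a0], h4, by linarith only [h0, h1, h6]⟩

set_option maxHeartbeats 1000000 in
lemma regF_step (K v x y v' x' y' : ℝ) (hK1 : 1 ≤ K) (hK2 : K ≤ 1.1)
    (hs : NStep K v x y v' x' y') (hR : RegF v x y) (hx49 : x ≤ 0.49) :
    1.68 * x ≤ x' ∧ (x' ≤ 0.49 → RegF v' x' y') ∧ (0.49 ≤ x' → RegE v' x' y') := by
  obtain ⟨hx, _, r3, r4, hy0, r5, r6⟩ := hR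
  have hv : 0 < v := by linarith only [hx, r3]
  obtain ⟨p, r, w, h, g, hp, hr, hvp, hyr, hw, hw0, h0, h1, hl, hu, g0, g1, g2, ex, ev, ey⟩ :=
    bridge K v x y v' x' y' hv hx hy0 hs.1 hs.2.1 hs.2.2
  clear hs
  have hp1 : 0.94 ≤ p := by rw [hvp] at r3; exact le_of_mul_le_mul_right r3 hx
  have hp2 : p ≤ 1.15 := by rw [hvp] at r4; exact le_of_mul_le_mul_right r4 hx
  have hr2 : r ≤ 0.8 := by rw [hyr] at r5; exact le_of_mul_le_mul_right r5 hx
  have hxs : x ^ 2 ≤ 0.49 ^ 2 := pow_le_pow_left₀ hx.le hx49 2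
  norm_num at hxs
  have hrx : r * x ≤ 0.25 := by linarith only [r6, hyr]
  have hrs : r ^ 2 * x ^ 2 ≤ 0.0625 := by
    have : (r * x) ^ 2 ≤ 0.25 ^ 2 := pow_le_pow_left₀ (mul_nonneg hr hx.le) hrx 2
    norm_num at this ⊢
    linarith only [this]
  obtain ⟨s1, s2, s3, s4, s5⟩ := stepR K p r (x ^ 2) w h g hK1 hK2 hp1 hp2 hr hr2 (by positivity)
    (by norm_num; linarith only [hxs]) hw hrs h0 h1 hl g0 g2
  have hy' := stepR_y K p r x w h hK1 hK2 hp1 hp2 hr hr2 hx hw hrx h1 s2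
  have hx' := stepR_x K p x w g hK1 hK2 hp1 hp2 hx hx49 hw g0
  rw [← ey] at hy'
  rw [← ex] at hx'
  have M : ∀ A B : ℝ, A ≤ B → x * A ≤ x * B := fun A B h => mul_le_mul_of_nonneg_left h hx.le
  have ey2 : y' = x * (r * (1 + K * p * (h - w))) := by
    rw [ey, abs_of_nonneg (mul_nonneg hx.le (mul_nonneg hr s2))]
  have t1 : 1.68 * x ≤ x' := by rw [ex]; linarith only [M _ _ s1, M, s1]
  have t2 : y' ≤ 0.51 * x' := by rw [ex, ey2]; linarith only [M _ _ s3, M, s3]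
  have t3 : 0.96 * x' ≤ v' := by rw [ex, ev]; linarith only [M _ _ s4, M, s4]
  have t4 : v' ≤ 1.07 * x' := by rw [ex, ev]; linarith only [M _ _ s5, M, s5]
  have t5 : 0 ≤ y' := by rw [ey]; exact abs_nonneg _
  clear ex ev ey ey2 s1 s2 s3 s4 s5
  have hx0' : 0 < x' := by linarith only [hx, t1]
  refine ⟨t1, fun hc => ?_, fun hc => ?_⟩
  · exact ⟨hx0', by linarith only [hx, t1, hc], by linarith only [hx, t1, t3], by linarith only [hx, t1, t4], t5, by linarith only [hx, t1, t2], by linarith only [hx, t1, t2, hc]⟩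
  · have a0 : x' ^ 2 ≤ 0.943 ^ 2 := pow_le_pow_left₀ hx0'.le hx' 2
    have a1 : (0.96 * x') ^ 2 ≤ v' ^ 2 := pow_le_pow_left₀ (by linarith only [hx, t1]) t3 2
    have a2 : v' ^ 2 ≤ (1.07 * x') ^ 2 := pow_le_pow_left₀ (by linarith only [hx, t1, t3]) t4 2
    norm_num at a0
    exact ⟨hc, by linarith only [hx49, hx, hx'], by linarith only [hx, t1, t3], by linarith only [hx, t1, t4], by linarith only [hx49, hx, hx', t4], by linarith only [hx49, hx, a2, a0], by linarith only [hx49, hx, a1, a0], t5, hy'⟩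

/-- The phase length `N = ⌈log_{2.56}(1.35/(π β²))⌉` is a natural number `T ≥ 4` with
`ε * 1.6 ^ T ≥ 0.4854`. -/
lemma phase_length (ε : ℝ) (hε1 : 0 < ε) (hε2 : ε ≤ 0.10) :
    ∃ T : ℕ, (T : ℤ) ≤ ⌈Real.logb 2.56 (1.35 / (Real.pi * ((1 + 1.1 / Real.pi) * ε) ^ 2))⌉ ∧
      4 ≤ T ∧ 0.4854 ≤ ε * (1.6 : ℝ) ^ T := by
  have hpi := Real.pi_pos
  have hpu := Real.pi_lt_d4
  have hpl := Real.pi_gt_d4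
  set A : ℝ := 1.35 / (Real.pi * ((1 + 1.1 / Real.pi) * ε) ^ 2) with hA
  have hi : 1 / π ≤ 0.3184 := by
    rw [div_le_iff₀ hpi]; linarith only [hpu, hpl]
  have e1 : Real.pi * ((1 + 1.1 / Real.pi) * ε) ^ 2 = (π + 2.2 + 1.21 * (1 / π)) * ε ^ 2 := by
    field_simp; ring
  have hε : 0 < ε ^ 2 := by positivity
  have hd : Real.pi * ((1 + 1.1 / Real.pi) * ε) ^ 2 ≤ 5.727 * ε ^ 2 := by
    rw [e1]
    apply mul_le_mul_of_nonneg_right _ hε.le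
    linarith only [hpu, hpl, hi]
  have hdp : 0 < Real.pi * ((1 + 1.1 / Real.pi) * ε) ^ 2 := by positivity
  have hAp : 0 < A := by positivity
  have hAl : 0.2357 ≤ A * ε ^ 2 := by
    have : A * (Real.pi * ((1 + 1.1 / Real.pi) * ε) ^ 2) = 1.35 := by
      rw [hA]; field_simp
    have h2 := mul_le_mul_of_nonneg_left hd hAp.le
    nlinarith only [hpu, hpl, this, h2]
  have hε3 : ε ^ 2 ≤ 0.01 := by nlinarith only [hε2, hε1]
  have hA1 : 23.57 ≤ A := by
    have := mul_le_mul_of_nonneg_left hε3 hAp.le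
    linarith only [hAl, this]
  have hlog : 0 < Real.logb 2.56 A := Real.logb_pos (by norm_num) (by linarith only [hε, hε3, hA1])
  have hN : 0 < ⌈Real.logb 2.56 A⌉ := Int.ceil_pos.mpr hlog
  obtain ⟨T, hT⟩ := Int.eq_ofNat_of_zero_le hN.le
  have hle : Real.logb 2.56 A ≤ (T : ℝ) := by
    have := Int.le_ceil (Real.logb 2.56 A)
    rw [hT] at this
    exact_mod_cast this
  rw [Real.logb_le_iff_le_rpow (by norm_num) hAp, Real.rpow_natCast] at hle
  refine ⟨T, by rw [hT], ?_, ?_⟩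
  · by_contra hlt
    have h3 : T ≤ 3 := by omega
    have : (2.56 : ℝ) ^ T ≤ 2.56 ^ 3 := pow_le_pow_right₀ (by norm_num) h3
    norm_num at this
    linarith only [hε, hε3, hA1, hle, this]
  · have hsq : (ε * (1.6 : ℝ) ^ T) ^ 2 = 2.56 ^ T * ε ^ 2 := by
      have : (2.56 : ℝ) = 1.6 ^ 2 := by norm_num
      rw [this, mul_pow, ← pow_mul, ← pow_mul, mul_comm T 2, mul_comm]
    have h2 := mul_le_mul_of_nonneg_right hle hε.le
    refine (sq_le_sq₀ (by norm_num) (by positivity : 0 ≤ ε * (1.6 : ℝ) ^ T)).mp ?_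
    rw [hsq]
    norm_num at hAl ⊢
    norm_num at h2
    linarith only [hε, hε3, hAl, h2]

/-- For gradient descent with learning rate `η = K d`, `K ∈ (1, 1.1]`,
on the population loss of a two-layer single-ReLU-neuron student learning the teacher
`w̃ = [1, 0]` (reduced to the coordinates `v`, `wₓ`, `w_y`), with balanced small
initialization `v₀ = ‖w₀‖ = ε ∈ (0, 0.10]` and `⟨w₀, w̃⟩ ≥ 0`, the orthogonal component
`w_y` eventually decays geometrically:  there is a phase length
`T₁ ≤ ⌈log_{2.56}(1.35/(π β²))⌉` with `β = (1 + 1.1/π) ε` such that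
`w_{y,t} < 0.1 (1 − 0.030 K)^{t − T₁ − 4}` for all `t ≥ T₁ + 4`. -/
theorem single_neuron_alignment
    (K ε : ℝ) (v wx wy : ℕ → ℝ)
    (hK1 : 1 < K) (hK2 : K ≤ 1.1)
    (hε1 : 0 < ε) (hε2 : ε ≤ 0.10)
    (hv0 : v 0 = ε)
    (hw0 : Real.sqrt (wx 0 ^ 2 + wy 0 ^ 2) = ε)
    (hwx0 : 0 ≤ wx 0) (hwy0 : 0 ≤ wy 0)
    (hvrec : ∀ t, v (t + 1) = v t
      + K * wx t * (1 - v t * wx t - neuronGamma (wx t) (wy t))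
      + K * (wy t ^ 2 / v t)
          * (-(v t ^ 2) + v t * wy t / (Real.pi * (wx t ^ 2 + wy t ^ 2))))
    (hwxrec : ∀ t, wx (t + 1) = wx t
      + K * v t * (1 - v t * wx t - neuronGamma (wx t) (wy t)))
    (hwyrec : ∀ t, wy (t + 1) = |wy t
      + K * wy t * (-(v t ^ 2) + v t * wy t / (Real.pi * (wx t ^ 2 + wy t ^ 2)))|) :
    ∃ T₁ : ℕ,
      (T₁ : ℤ) ≤ ⌈Real.logb 2.56 (1.35 / (Real.pi * ((1 + 1.1 / Real.pi) * ε) ^ 2))⌉ ∧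
      ∀ t : ℕ, T₁ + 4 ≤ t → wy t < 0.1 * (1 - 0.030 * K) ^ (t - T₁ - 4) := by
  obtain ⟨T, hT, hT4, hTε⟩ := phase_length ε hε1 hε2
  refine ⟨T, hT, ?_⟩
  have hε3 : ε ≤ 0.1 := by linarith only [hε2]
  have hK : (1 : ℝ) ≤ K := hK1.le
  have hS : ∀ t, NStep K (v t) (wx t) (wy t) (v (t + 1)) (wx (t + 1)) (wy (t + 1)) :=
    fun t => ⟨hvrec t, hwxrec t, hwyrec t⟩
  have hn : wx 0 ^ 2 + wy 0 ^ 2 = ε ^ 2 := by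
    rw [← hw0, Real.sq_sqrt (by positivity)]
  have hs0 := hS 0
  rw [hv0] at hs0
  have hA := step0 K ε _ _ _ _ _ hK hK2 hε1 hε3 hwx0 hwy0 hn hs0
  have hB := regA_step K ε _ _ _ _ _ _ hK hK2 hε1 (hS 1) hA
  obtain ⟨hF, hx3⟩ := regB_step K ε _ _ _ _ _ _ hK hK2 hε1 hε3 (hS 2) hB
  -- growth phase
  have hgrow : ∀ k : ℕ, (∃ τ ≤ 3 + k, RegE (v τ) (wx τ) (wy τ)) ∨
      (RegF (v (3 + k)) (wx (3 + k)) (wy (3 + k)) ∧ wx (3 + k) ≤ 0.49 ∧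
        (1.68 : ℝ) ^ k * (2.4 * ε) ≤ wx (3 + k)) := by
    intro k
    induction k with
    | zero =>
      rcases le_total (wx 3) 0.49 with h | h
      · exact Or.inr ⟨hF, h, by simpa using hx3⟩
      · exact Or.inl ⟨3, le_refl _, regF_big _ _ _ hF h⟩
    | succ k ih =>
      rcases ih with ⟨τ, hτ, hE⟩ | ⟨hFk, hk, hxk⟩
      · exact Or.inl ⟨τ, by omega, hE⟩
      · obtain ⟨h1, h2, h3⟩ := regF_step K _ _ _ _ _ _ hK hK2 (hS (3 + k)) hFk hk
        rcases le_total (wx (3 + k + 1)) 0.49 with h | h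
        · refine Or.inr ⟨h2 h, h, ?_⟩
          have : (1.68 : ℝ) ^ (k + 1) * (2.4 * ε) = 1.68 * (1.68 ^ k * (2.4 * ε)) := by ring
          rw [this]
          exact le_trans (mul_le_mul_of_nonneg_left hxk (by norm_num)) h1
        · exact Or.inl ⟨3 + k + 1, by omega, h3 h⟩
  have hE : ∃ τ ≤ T + 1, RegE (v τ) (wx τ) (wy τ) := by
    obtain ⟨m, rfl⟩ : ∃ m, T = m + 4 := ⟨T - 4, by omega⟩
    rcases hgrow (m + 2) with ⟨τ, hτ, hE⟩ | ⟨_, h1, h2⟩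
    · exact ⟨τ, by omega, hE⟩
    · exfalso
      have h3 : (1.6 : ℝ) ^ m ≤ 1.68 ^ m := pow_le_pow_left₀ (by norm_num) (by norm_num) m
      have h4 : (1.68 : ℝ) ^ (m + 2) * (2.4 * ε) = 6.77376 * (1.68 ^ m * ε) := by
        rw [pow_add]; ring
      have h5 : ε * (1.6 : ℝ) ^ (m + 4) = 6.5536 * (1.6 ^ m * ε) := by
        rw [pow_add]; ring
      have h6 := mul_le_mul_of_nonneg_right h3 hε1.le
      rw [h4] at h2
      rw [h5] at hTε
      linarith only [hK1, hK2, hTε, h1, h2, h6]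
  obtain ⟨τ, hτ, hE⟩ := hE
  have hC := regE_step K _ _ _ _ _ _ hK hK2 (hS τ) hE
  have hD := regC_step K _ _ _ _ _ _ hK hK2 (hS (τ + 1)) hC
  have hdec : ∀ j : ℕ, RegD (v (τ + 2 + j)) (wx (τ + 2 + j)) (wy (τ + 2 + j)) ∧
      wy (τ + 2 + j) ≤ 0.14 * (0.7 : ℝ) ^ j := by
    intro j
    induction j with
    | zero => exact ⟨hD, by simpa using hD.2.2.2.2.2⟩
    | succ j ih =>
      obtain ⟨h1, h2⟩ := regD_step K _ _ _ _ _ _ hK hK2 (hS (τ + 2 + j)) ih.1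
      refine ⟨h1, h2.trans ?_⟩
      have : 0.14 * (0.7 : ℝ) ^ (j + 1) = 0.7 * (0.14 * 0.7 ^ j) := by ring
      rw [this]
      exact mul_le_mul_of_nonneg_left ih.2 (by norm_num)
  intro t ht
  obtain ⟨i, rfl⟩ : ∃ i, t = T + 4 + i := ⟨t - (T + 4), by omega⟩
  have hi : T + 4 + i - T - 4 = i := by omega
  rw [hi]
  obtain ⟨j, hj⟩ : ∃ j, T + 4 + i = τ + 2 + j := ⟨T + 4 + i - (τ + 2), by omega⟩
  have h1 := (hdec j).2
  rw [← hj] at h1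
  have h2 : (0.7 : ℝ) ^ j ≤ 0.7 ^ (i + 1) :=
    pow_le_pow_of_le_one (by norm_num) (by norm_num) (by omega)
  have h3 : (0.7 : ℝ) ^ i ≤ (1 - 0.030 * K) ^ i :=
    pow_le_pow_left₀ (by norm_num) (by linarith only [hK1, hK2]) i
  have h4 : (0 : ℝ) < 0.7 ^ i := by positivity
  rw [pow_succ] at h2
  linarith only [h1, h2, h3, h4]
end

section
/- Let X ∈ ℝ^{m×p}, Y ∈ ℝ^{p×q} with X·Y = C, let σ_{x,1}, u_{x,1}, v_{x,1} and σ_{y,1}, u_{y,1}, v_{y,1} be the (simple) top singular values and corresponding singular vectors of X and Y respectively, assume v_{x,1}ᵀ·u_{y,1} ≠ 0, and set ΔX = C₁·u_{x,1}·u_{y,1}ᵀ, ΔY = C₂·v_{x,1}·v_{y,1}ᵀ with C₁ = σ_{y,1}/√(σ_{x,1}² + σ_{y,1}²), C₂ = σ_{x,1}/√(σ_{x,1}² + σ_{y,1}²). Define f_Δ(t) = (1/2)·‖(X + t·ΔX)·(Y + t·ΔY) − C‖_F² for t ∈ ℝ. Then f_Δ''(0) = ‖ΔX·Y + X·ΔY‖_F²,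 f_Δ'''(0) = 6·⟨ΔX·Y + X·ΔY, ΔX·ΔY⟩, f_Δ⁽⁴⁾(0) = 12·‖ΔX·ΔY‖_F², and 3·f_Δ'''(0)² − f_Δ''(0)·f_Δ⁽⁴⁾(0) = 96·‖ΔX·Y + X·ΔY‖_F²·‖ΔX·ΔY‖_F² > 0. -/
open Matrix

/-- Squared Frobenius norm of a real matrix. -/
noncomputable def frobSq {m n : ℕ} (M : Matrix (Fin m) (Fin n) ℝ) : ℝ :=
  ∑ i, ∑ j, (M i j) ^ 2

/-- Frobenius inner product of two real matrices. -/
noncomputable def frobInner {m n : ℕ} (A B : Matrix (Fin m) (Fin n) ℝ) : ℝ :=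
  ∑ i, ∑ j, A i j * B i j

lemma deriv_quartic (a b c d e : ℝ) :
    deriv (fun t : ℝ => a + b * t + c * t ^ 2 + d * t ^ 3 + e * t ^ 4)
      = fun t : ℝ => b + (2 * c) * t + (3 * d) * t ^ 2 + (4 * e) * t ^ 3 + 0 * t ^ 4 := by
  funext t
  have h : HasDerivAt (fun t : ℝ => a + b * t + c * t ^ 2 + d * t ^ 3 + e * t ^ 4)
      (0 + b * 1 + c * ((2 : ℕ) * t ^ (2 - 1)) + d * ((3 : ℕ) * t ^ (3 - 1))
        + e * ((4 : ℕ) * t ^ (4 - 1))) t :=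
    ((((hasDerivAt_const t a).add ((hasDerivAt_id t).const_mul b)).add
      ((hasDerivAt_pow 2 t).const_mul c)).add ((hasDerivAt_pow 3 t).const_mul d)).add
      ((hasDerivAt_pow 4 t).const_mul e)
  rw [h.deriv]
  norm_num
  ring

lemma frobSq_smul_outer {m n : ℕ} (c : ℝ) (u : Fin m → ℝ) (v : Fin n → ℝ)
    (hu : dotProduct u u = 1) (hv : dotProduct v v = 1) :
    frobSq (c • vecMulVec u v) = c ^ 2 := by
  have : frobSq (c • vecMulVec u v) = c ^ 2 * (dotProduct u u * dotProduct v v) := by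
    simp only [frobSq, dotProduct, Finset.sum_mul_sum, Matrix.smul_apply,
      vecMulVec_apply, smul_eq_mul]
    simp only [Finset.mul_sum]
    refine Finset.sum_congr rfl fun i _ => Finset.sum_congr rfl fun j _ => ?_
    ring
  rw [this, hu, hv]; ring

lemma frobInner_smul_outer {m n : ℕ} (c d : ℝ) (u : Fin m → ℝ) (v : Fin n → ℝ)
    (hu : dotProduct u u = 1) (hv : dotProduct v v = 1) :
    frobInner (c • vecMulVec u v) (d • vecMulVec u v) = c * d := by
  have : frobInner (c • vecMulVec u v) (d • vecMulVec u v)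
      = c * d * (dotProduct u u * dotProduct v v) := by
    simp only [frobInner, dotProduct, Finset.sum_mul_sum, Matrix.smul_apply,
      vecMulVec_apply, smul_eq_mul]
    simp only [Finset.mul_sum]
    refine Finset.sum_congr rfl fun i _ => Finset.sum_congr rfl fun j _ => ?_
    ring
  rw [this, hu, hv]; ring

/-- At a global minimum `X Y = C` of the matrix-factorization loss,
let `(ΔX, ΔY)` be the leading Hessian eigendirection built from the (simple, positive)
top singular data of `X` and `Y`, with `v_{x,1}ᵀ u_{y,1} ≠ 0`.  The one-dimensional
cross-section `f_Δ(t) = (1/2)‖(X + tΔX)(Y + tΔY) − C‖_F²` satisfies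
`f_Δ''(0) = ‖ΔX Y + X ΔY‖_F²`, `f_Δ'''(0) = 6⟨ΔX Y + X ΔY, ΔX ΔY⟩`,
`f_Δ⁗(0) = 12‖ΔX ΔY‖_F²`, and
`3 f_Δ'''(0)² − f_Δ''(0) f_Δ⁗(0) = 96 ‖ΔX Y + X ΔY‖_F² ‖ΔX ΔY‖_F² > 0`. -/
theorem matrix_factorization_one_dim_condition
    (m p q : ℕ) (hmp : 0 < min m p) (hpq : 0 < min p q)
    (X : Matrix (Fin m) (Fin p) ℝ) (Y : Matrix (Fin p) (Fin q) ℝ)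
    (C : Matrix (Fin m) (Fin q) ℝ) (hC : X * Y = C)
    (σx : Fin (min m p) → ℝ) (ux : Fin (min m p) → Fin m → ℝ)
    (vx : Fin (min m p) → Fin p → ℝ)
    (σy : Fin (min p q) → ℝ) (uy : Fin (min p q) → Fin p → ℝ)
    (vy : Fin (min p q) → Fin q → ℝ)
    (hX : X = ∑ i, σx i • vecMulVec (ux i) (vx i))
    (hY : Y = ∑ i, σy i • vecMulVec (uy i) (vy i))
    (hux : ∀ i j, dotProduct (ux i) (ux j) = if i = j then (1 : ℝ) else 0)
    (hvx : ∀ i j, dotProduct (vx i) (vx j) = if i = j then (1 : ℝ) else 0)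
    (huy : ∀ i j, dotProduct (uy i) (uy j) = if i = j then (1 : ℝ) else 0)
    (hvy : ∀ i j, dotProduct (vy i) (vy j) = if i = j then (1 : ℝ) else 0)
    (hσx0 : ∀ i, 0 ≤ σx i) (hσxanti : Antitone σx)
    (hσy0 : ∀ i, 0 ≤ σy i) (hσyanti : Antitone σy)
    (hσxtop : ∀ i : Fin (min m p), i ≠ ⟨0, hmp⟩ → σx i < σx ⟨0, hmp⟩)
    (hσytop : ∀ i : Fin (min p q), i ≠ ⟨0, hpq⟩ → σy i < σy ⟨0, hpq⟩)
    (hσxpos : 0 < σx ⟨0, hmp⟩) (hσypos : 0 < σy ⟨0, hpq⟩)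
    (hvu : dotProduct (vx ⟨0, hmp⟩) (uy ⟨0, hpq⟩) ≠ 0)
    (ΔX : Matrix (Fin m) (Fin p) ℝ) (ΔY : Matrix (Fin p) (Fin q) ℝ)
    (hΔX : ΔX = (σy ⟨0, hpq⟩ / Real.sqrt (σx ⟨0, hmp⟩ ^ 2 + σy ⟨0, hpq⟩ ^ 2)) •
        vecMulVec (ux ⟨0, hmp⟩) (uy ⟨0, hpq⟩))
    (hΔY : ΔY = (σx ⟨0, hmp⟩ / Real.sqrt (σx ⟨0, hmp⟩ ^ 2 + σy ⟨0, hpq⟩ ^ 2)) •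
        vecMulVec (vx ⟨0, hmp⟩) (vy ⟨0, hpq⟩)) :
    iteratedDeriv 2 (fun t : ℝ => (1 / 2) * frobSq ((X + t • ΔX) * (Y + t • ΔY) - C)) 0
      = frobSq (ΔX * Y + X * ΔY) ∧
    iteratedDeriv 3 (fun t : ℝ => (1 / 2) * frobSq ((X + t • ΔX) * (Y + t • ΔY) - C)) 0
      = 6 * frobInner (ΔX * Y + X * ΔY) (ΔX * ΔY) ∧
    iteratedDeriv 4 (fun t : ℝ => (1 / 2) * frobSq ((X + t • ΔX) * (Y + t • ΔY) - C)) 0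
      = 12 * frobSq (ΔX * ΔY) ∧
    3 * (iteratedDeriv 3
          (fun t : ℝ => (1 / 2) * frobSq ((X + t • ΔX) * (Y + t • ΔY) - C)) 0) ^ 2
      - iteratedDeriv 2
          (fun t : ℝ => (1 / 2) * frobSq ((X + t • ΔX) * (Y + t • ΔY) - C)) 0
        * iteratedDeriv 4
            (fun t : ℝ => (1 / 2) * frobSq ((X + t • ΔX) * (Y + t • ΔY) - C)) 0
      = 96 * frobSq (ΔX * Y + X * ΔY) * frobSq (ΔX * ΔY) ∧
    0 < 96 * frobSq (ΔX * Y + X * ΔY) * frobSq (ΔX * ΔY) := by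
  have hu1 := hux ⟨0, hmp⟩ ⟨0, hmp⟩
  have hv1 := hvy ⟨0, hpq⟩ ⟨0, hpq⟩
  rw [if_pos rfl] at hu1 hv1
  have hYu : vecMulVec (ux ⟨0, hmp⟩) (uy ⟨0, hpq⟩) * Y
      = σy ⟨0, hpq⟩ • vecMulVec (ux ⟨0, hmp⟩) (vy ⟨0, hpq⟩) := by
    rw [hY, Matrix.mul_sum, Finset.sum_eq_single ⟨0, hpq⟩]
    · rw [Matrix.mul_smul, vecMulVec_mul_vecMulVec, huy, if_pos rfl, one_smul]
    · intro i _ hi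
      rw [Matrix.mul_smul, vecMulVec_mul_vecMulVec, huy, if_neg (Ne.symm hi)]
      rw [vecMulVec_smul, zero_smul, smul_zero]
    · simp
  have hXv : X * vecMulVec (vx ⟨0, hmp⟩) (vy ⟨0, hpq⟩)
      = σx ⟨0, hmp⟩ • vecMulVec (ux ⟨0, hmp⟩) (vy ⟨0, hpq⟩) := by
    rw [hX, Matrix.sum_mul, Finset.sum_eq_single ⟨0, hmp⟩]
    · rw [Matrix.smul_mul, vecMulVec_mul_vecMulVec, hvx, if_pos rfl, one_smul]
    · intro i _ hi
      rw [Matrix.smul_mul, vecMulVec_mul_vecMulVec, hvx, if_neg hi]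
      rw [vecMulVec_smul, zero_smul, smul_zero]
    · simp
  have hB0 : vecMulVec (ux ⟨0, hmp⟩) (uy ⟨0, hpq⟩) * vecMulVec (vx ⟨0, hmp⟩) (vy ⟨0, hpq⟩)
      = dotProduct (vx ⟨0, hmp⟩) (uy ⟨0, hpq⟩) •
        vecMulVec (ux ⟨0, hmp⟩) (vy ⟨0, hpq⟩) := by
    rw [vecMulVec_mul_vecMulVec, dotProduct_comm, vecMulVec_smul]
  have hs : 0 < Real.sqrt (σx ⟨0, hmp⟩ ^ 2 + σy ⟨0, hpq⟩ ^ 2) := Real.sqrt_pos.mpr (by positivity)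
  generalize Real.sqrt (σx ⟨0, hmp⟩ ^ 2 + σy ⟨0, hpq⟩ ^ 2) = s at *
  obtain ⟨a, ha, hA⟩ : ∃ a : ℝ, 0 < a ∧ ΔX * Y + X * ΔY
      = a • vecMulVec (ux ⟨0, hmp⟩) (vy ⟨0, hpq⟩) := by
    refine ⟨σy ⟨0, hpq⟩ / s * σy ⟨0, hpq⟩ + σx ⟨0, hmp⟩ / s * σx ⟨0, hmp⟩, by positivity, ?_⟩
    rw [hΔX, hΔY, Matrix.smul_mul, Matrix.mul_smul, hYu, hXv, smul_smul, smul_smul, add_smul]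
  obtain ⟨b, hb, hB⟩ : ∃ b : ℝ, b ≠ 0 ∧ ΔX * ΔY
      = b • vecMulVec (ux ⟨0, hmp⟩) (vy ⟨0, hpq⟩) := by
    refine ⟨σy ⟨0, hpq⟩ / s * (σx ⟨0, hmp⟩ / s * dotProduct (vx ⟨0, hmp⟩) (uy ⟨0, hpq⟩)), ?_, ?_⟩
    · have := hσxpos.ne'
      have := hσypos.ne'
      have := hs.ne'
      positivity
    · rw [hΔX, hΔY, Matrix.smul_mul, Matrix.mul_smul, hB0, smul_smul, smul_smul, mul_assoc]
  have hf : (fun t : ℝ => (1 / 2) * frobSq ((X + t • ΔX) * (Y + t • ΔY) - C))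
      = fun t : ℝ => 0 + 0 * t + (a ^ 2 / 2) * t ^ 2 + (a * b) * t ^ 3 + (b ^ 2 / 2) * t ^ 4 := by
    funext t
    have : (X + t • ΔX) * (Y + t • ΔY) - C
        = (t * a + t * t * b) • vecMulVec (ux ⟨0, hmp⟩) (vy ⟨0, hpq⟩) := by
      have h1 : (X + t • ΔX) * (Y + t • ΔY) - C
          = t • (ΔX * Y + X * ΔY) + (t * t) • (ΔX * ΔY) := by
        rw [← hC, Matrix.add_mul, Matrix.mul_add, Matrix.mul_add, Matrix.smul_mul,
          Matrix.smul_mul, Matrix.mul_smul, Matrix.mul_smul, smul_smul, smul_add]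
        abel
      rw [h1, hA, hB, smul_smul, smul_smul, add_smul]
    rw [this, frobSq_smul_outer _ _ _ hu1 hv1]
    ring
  have e2 : iteratedDeriv 2 (fun t : ℝ =>
      (1 / 2) * frobSq ((X + t • ΔX) * (Y + t • ΔY) - C)) 0 = a ^ 2 := by
    rw [hf]
    simp only [iteratedDeriv_succ', iteratedDeriv_zero, deriv_quartic]
    ring
  have e3 : iteratedDeriv 3 (fun t : ℝ =>
      (1 / 2) * frobSq ((X + t • ΔX) * (Y + t • ΔY) - C)) 0 = 6 * (a * b) := by
    rw [hf]
    simp only [iteratedDeriv_succ', iteratedDeriv_zero, deriv_quartic]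
    ring
  have e4 : iteratedDeriv 4 (fun t : ℝ =>
      (1 / 2) * frobSq ((X + t • ΔX) * (Y + t • ΔY) - C)) 0 = 12 * b ^ 2 := by
    rw [hf]
    simp only [iteratedDeriv_succ', iteratedDeriv_zero, deriv_quartic]
    ring
  rw [e2, e3, e4, hA, hB, frobSq_smul_outer _ _ _ hu1 hv1, frobSq_smul_outer _ _ _ hu1 hv1,
    frobInner_smul_outer _ _ _ _ hu1 hv1]
  refine ⟨rfl, rfl, rfl, by ring, by positivity⟩
end

section
/- Let σ₁ > σ_p > 0, α > 0, η > 0, and suppose max{ η·(σ₁²/α²)·(1 + α⁴·σ_p²/σ₁²), η·σ₁²·α²·(1 + σ_p²/(α⁴·σ₁²)) } ≤ 2. Define the 4×4 real matrix A with rows: (1 − η·σ₁²/α², 0, 0, −η·σ₁·σ_p), (0, 1 − η·σ₁²·α², −η·σ₁·σ_p, 0), (−η·σ₁·σ_p, 0, 1, −η·α²·σ_p²), (0, −η·σ₁·σ_p, −η·σ_p²/α², 1). Then the powers of A are uniformly bounded: there exists M > 0 such that every entry of Aᵗ has absolute value at most M for all integers t ≥ 1. -/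
/-- Contraction of the symmetric two-dimensional recursion. -/
theorem qs_uv_bound (s b r : ℝ) (u v : ℕ → ℝ)
    (h0 : ∀ x y : ℝ, 0 ≤ s * x ^ 2 + 2 * b * x * y + r * y ^ 2)
    (h2 : ∀ x y : ℝ, 0 ≤ (2 - s) * x ^ 2 - 2 * b * x * y + (2 - r) * y ^ 2)
    (hu : ∀ t, u (t + 1) = u t - (s * u t + b * v t))
    (hv : ∀ t, v (t + 1) = v t - (b * u t + r * v t)) :
    ∃ N : ℝ, ∀ t, |u t| ≤ N ∧ |v t| ≤ N := by
  have key : ∀ t, u t ^ 2 + v t ^ 2 ≤ u 0 ^ 2 + v 0 ^ 2 := by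
    intro t
    induction t with
    | zero => exact le_rfl
    | succ t ih =>
      refine le_trans ?_ ih
      rw [hu, hv]
      have e1 := h2 (s * u t + b * v t) (b * u t + r * v t)
      have e2 := h0 (2 * u t - (s * u t + b * v t)) (2 * v t - (b * u t + r * v t))
      linarith
  refine ⟨√(u 0 ^ 2 + v 0 ^ 2), fun t => ⟨?_, ?_⟩⟩
  · exact Real.abs_le_sqrt (by nlinarith [key t, sq_nonneg (v t)])
  · exact Real.abs_le_sqrt (by nlinarith [key t, sq_nonneg (u t)])

/-- A sequence driven linearly by the two-dimensional recursion stays bounded. -/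
theorem qs_x_bound (s b r c d N : ℝ) (u v x : ℕ → ℝ) (hD : s * r - b ^ 2 ≠ 0)
    (hu : ∀ t, u (t + 1) = u t - (s * u t + b * v t))
    (hv : ∀ t, v (t + 1) = v t - (b * u t + r * v t))
    (hN : ∀ t, |u t| ≤ N ∧ |v t| ≤ N)
    (hx : ∀ t, x (t + 1) = x t - (c * u t + d * v t)) :
    ∃ M : ℝ, ∀ t, |x t| ≤ M := by
  obtain ⟨p, q, h1, h2⟩ : ∃ p q : ℝ, p * s + q * b = c ∧ p * b + q * r = d := by
    refine ⟨(c * r - d * b) / (s * r - b ^ 2), (d * s - c * b) / (s * r - b ^ 2), ?_, ?_⟩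
    · rw [div_mul_eq_mul_div, div_mul_eq_mul_div, ← add_div, div_eq_iff hD]
      ring
    · rw [div_mul_eq_mul_div, div_mul_eq_mul_div, ← add_div, div_eq_iff hD]
      ring
  have inv : ∀ t, x t = (x 0 - p * u 0 - q * v 0) + p * u t + q * v t := by
    intro t
    induction t with
    | zero => ring
    | succ t ih =>
      rw [hx, hu, hv]
      linear_combination ih + u t * h1 + v t * h2
  refine ⟨|x 0 - p * u 0 - q * v 0| + |p| * N + |q| * N, fun t => ?_⟩
  rw [inv t]
  refine (abs_add_three _ _ _).trans ?_
  rw [abs_mul, abs_mul]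
  have := hN t
  gcongr
  · exact this.1
  · exact this.2

/-- The 4×4 one-step linearization matrix of the quasi-symmetric
matrix-factorization dynamics around the minimizer `(α X₀, (1/α) X₀)` (coupling a
non-leading singular direction with singular value `σ_p < σ₁`) has uniformly bounded
powers whenever
`max{η (σ₁²/α²)(1 + α⁴ σ_p²/σ₁²), η σ₁² α² (1 + σ_p²/(α⁴ σ₁²))} ≤ 2`. -/
theorem quasi_symmetric_linearization_bounded_powers
    (σ1 σp α η : ℝ) (hσp : 0 < σp) (hσ1 : σp < σ1) (hα : 0 < α) (hη : 0 < η)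
    (hmax : max (η * (σ1 ^ 2 / α ^ 2) * (1 + α ^ 4 * σp ^ 2 / σ1 ^ 2))
        (η * σ1 ^ 2 * α ^ 2 * (1 + σp ^ 2 / (α ^ 4 * σ1 ^ 2))) ≤ 2)
    (A : Matrix (Fin 4) (Fin 4) ℝ)
    (hA : A = !![1 - η * σ1 ^ 2 / α ^ 2, 0, 0, -(η * σ1 * σp);
                 0, 1 - η * σ1 ^ 2 * α ^ 2, -(η * σ1 * σp), 0;
                 -(η * σ1 * σp), 0, 1, -(η * α ^ 2 * σp ^ 2);
                 0, -(η * σ1 * σp), -(η * σp ^ 2 / α ^ 2), 1]) :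
    ∃ M > (0 : ℝ), ∀ t : ℕ, 1 ≤ t → ∀ i j : Fin 4, |(A ^ t) i j| ≤ M := by
  have hσ : 0 < σ1 := hσp.trans hσ1
  have hm1 : η * (σ1 ^ 2 / α ^ 2) + η * (σp ^ 2 * α ^ 2) ≤ 2 := by
    refine le_trans (le_of_eq ?_) ((le_max_left _ _).trans hmax)
    field_simp
  have hm2 : η * (σ1 ^ 2 * α ^ 2) + η * (σp ^ 2 / α ^ 2) ≤ 2 := by
    refine le_trans (le_of_eq ?_) ((le_max_right _ _).trans hmax)
    field_simp
  have hsq : σp ^ 2 < σ1 ^ 2 := by gcongr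
  have h0 : ∀ x y : ℝ, 0 ≤ (η * σ1 ^ 2 / α ^ 2) * x ^ 2 + 2 * (η * σp ^ 2) * x * y
      + (η * σ1 ^ 2 * α ^ 2) * y ^ 2 := by
    intro x y
    have : (η * σ1 ^ 2 / α ^ 2) * x ^ 2 + 2 * (η * σp ^ 2) * x * y
      + (η * σ1 ^ 2 * α ^ 2) * y ^ 2 = η * σp ^ 2 * (x + α ^ 2 * y) ^ 2 / α ^ 2
        + η * (σ1 ^ 2 - σp ^ 2) * (x ^ 2 / α ^ 2 + α ^ 2 * y ^ 2) := by
      field_simp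
      ring
    rw [this]
    have : 0 ≤ σ1 ^ 2 - σp ^ 2 := by linarith
    positivity
  have h2 : ∀ x y : ℝ, 0 ≤ (2 - η * σ1 ^ 2 / α ^ 2) * x ^ 2 - 2 * (η * σp ^ 2) * x * y
      + (2 - η * σ1 ^ 2 * α ^ 2) * y ^ 2 := by
    intro x y
    have : (2 - η * σ1 ^ 2 / α ^ 2) * x ^ 2 - 2 * (η * σp ^ 2) * x * y
      + (2 - η * σ1 ^ 2 * α ^ 2) * y ^ 2 = η * σp ^ 2 * (α ^ 2 * x - y) ^ 2 / α ^ 2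
        + (2 - (η * (σ1 ^ 2 / α ^ 2) + η * (σp ^ 2 * α ^ 2))) * x ^ 2
        + (2 - (η * (σ1 ^ 2 * α ^ 2) + η * (σp ^ 2 / α ^ 2))) * y ^ 2 := by
      field_simp
      ring
    rw [this]
    have e1 := sub_nonneg.2 hm1
    have e2 := sub_nonneg.2 hm2
    positivity
  have hD : (η * σ1 ^ 2 / α ^ 2) * (η * σ1 ^ 2 * α ^ 2) - (η * σp ^ 2) ^ 2 ≠ 0 := by
    have : (η * σ1 ^ 2 / α ^ 2) * (η * σ1 ^ 2 * α ^ 2) - (η * σp ^ 2) ^ 2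
        = η ^ 2 * ((σ1 ^ 2 - σp ^ 2) * (σ1 ^ 2 + σp ^ 2)) := by
      field_simp
      ring
    rw [this]
    have : 0 < σ1 ^ 2 - σp ^ 2 := by linarith
    positivity
  have main : ∀ i j : Fin 4, ∃ M : ℝ, ∀ t : ℕ, |(A ^ t) i j| ≤ M := by
    intro i j
    have hrec : ∀ (t : ℕ) (i : Fin 4), (A ^ (t + 1)) i j = A i 0 * (A ^ t) 0 j
        + A i 1 * (A ^ t) 1 j + A i 2 * (A ^ t) 2 j + A i 3 * (A ^ t) 3 j := by
      intro t i
      rw [pow_succ', Matrix.mul_apply, Fin.sum_univ_four]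
    have r0 : ∀ t, (A ^ (t + 1)) 0 j = (1 - η * σ1 ^ 2 / α ^ 2) * (A ^ t) 0 j
        - η * σ1 * σp * (A ^ t) 3 j := by
      intro t
      rw [hrec t 0]
      generalize A ^ t = B
      simp [hA]
      ring
    have r1 : ∀ t, (A ^ (t + 1)) 1 j = (1 - η * σ1 ^ 2 * α ^ 2) * (A ^ t) 1 j
        - η * σ1 * σp * (A ^ t) 2 j := by
      intro t
      rw [hrec t 1]
      generalize A ^ t = B
      simp [hA]
      ring
    have r2 : ∀ t, (A ^ (t + 1)) 2 j = (A ^ t) 2 j - η * σ1 * σp * (A ^ t) 0 j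
        - η * α ^ 2 * σp ^ 2 * (A ^ t) 3 j := by
      intro t
      rw [hrec t 2]
      generalize A ^ t = B
      simp [hA]
      ring
    have r3 : ∀ t, (A ^ (t + 1)) 3 j = (A ^ t) 3 j - η * σ1 * σp * (A ^ t) 1 j
        - η * σp ^ 2 / α ^ 2 * (A ^ t) 2 j := by
      intro t
      rw [hrec t 3]
      generalize A ^ t = B
      simp [hA]
      ring
    clear hrec
    obtain ⟨u, hu⟩ : ∃ u : ℕ → ℝ, ∀ t, u t = σ1 * (A ^ t) 0 j + α ^ 2 * σp * (A ^ t) 3 j :=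
      ⟨_, fun _ => rfl⟩
    obtain ⟨v, hv⟩ : ∃ v : ℕ → ℝ, ∀ t, v t = σ1 * α ^ 2 * (A ^ t) 1 j + σp * (A ^ t) 2 j :=
      ⟨_, fun _ => rfl⟩
    have hu' : ∀ t, u (t + 1) = u t - (η * σ1 ^ 2 / α ^ 2 * u t + η * σp ^ 2 * v t) := by
      intro t
      rw [hu, hu, hv, r0, r3]
      field_simp
      ring
    have hv' : ∀ t, v (t + 1) = v t - (η * σp ^ 2 * u t + η * σ1 ^ 2 * α ^ 2 * v t) := by
      intro t
      rw [hv, hu, hv, r1, r2]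
      ring
    obtain ⟨N, hN⟩ := qs_uv_bound _ _ _ u v h0 h2 hu' hv'
    have hfin : ∀ c d : ℝ, (∀ t, (A ^ (t + 1)) i j = (A ^ t) i j - (c * u t + d * v t)) →
        ∃ M : ℝ, ∀ t : ℕ, |(A ^ t) i j| ≤ M := fun c d h =>
      qs_x_bound _ _ _ c d N u v (fun t => (A ^ t) i j) hD hu' hv' hN h
    fin_cases i
    · refine hfin (η * σ1 / α ^ 2) 0 fun t => ?_
      simp only [Fin.zero_eta, Fin.mk_one, Fin.reduceFinMk]
      rw [hu, hv, r0]
      field_simp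
      ring
    · refine hfin 0 (η * σ1) fun t => ?_
      simp only [Fin.zero_eta, Fin.mk_one, Fin.reduceFinMk]
      rw [hu, hv, r1]
      ring
    · refine hfin (η * σp) 0 fun t => ?_
      simp only [Fin.zero_eta, Fin.mk_one, Fin.reduceFinMk]
      rw [hu, hv, r2]
      ring
    · refine hfin 0 (η * σp / α ^ 2) fun t => ?_
      simp only [Fin.zero_eta, Fin.mk_one, Fin.reduceFinMk]
      rw [hu, hv, r3]
      field_simp
      ring
  choose M hM using main
  have hM0 : ∀ i j, 0 ≤ M i j := fun i j => (abs_nonneg _).trans (hM i j 0)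
  refine ⟨1 + ∑ i, ∑ j, M i j, ?_, fun t _ i j => ?_⟩
  · have : 0 ≤ ∑ i, ∑ j, M i j := Finset.sum_nonneg fun i _ => Finset.sum_nonneg fun j _ => hM0 i j
    linarith
  · have e1 : M i j ≤ ∑ j, M i j :=
      Finset.single_le_sum (f := fun j => M i j) (fun j _ => hM0 i j) (Finset.mem_univ j)
    have e2 : ∑ j, M i j ≤ ∑ i, ∑ j, M i j :=
      Finset.single_le_sum (f := fun i => ∑ j, M i j)
        (fun i _ => Finset.sum_nonneg fun j _ => hM0 i j) (Finset.mem_univ i)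
    linarith [hM i j t]
end
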